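/- arXiv:2512.00802 — 3 statements merged into one kernel-verified Lean document; each statement's English description precedes it below -/
import Mathlib

section
/- A closed set F ⊆ ℂ is an Arakelian set if and only if F possesses a neighborhood basis of simply connected open sets; that is, if and only if for every open set U ⊆ ℂ with F ⊆ U, there exists an open set V with F ⊆ V ⊆ U such that every connected component of V is simply connected. -/
open Complex Metric Bornology

/-- A closed set `F ⊆ ℂ` is Arakelian if every connected component of its complement
is unbounded, and for every compact `K`, the union of all bounded connected components
of `ℂ \ (F ∪ K)` is bounded. -/
def IsArakelian (F : Set ℂ) : Prop :=
  (∀ z ∈ Fᶜ, ¬ IsBounded (connectedComponentIn Fᶜ z)) ∧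
  (∀ K : Set ℂ, IsCompact K →
    IsBounded {z : ℂ | z ∈ (F ∪ K)ᶜ ∧ IsBounded (connectedComponentIn (F ∪ K)ᶜ z)})

namespace Ark
open Set Topology Filter unitInterval

/-- Any two paths in `W` with common endpoints are homotopic in `W`. -/
def SCC (W : Set ℂ) : Prop := ∀ (x y : W) (p q : Path x y), p.Homotopic q

/-- restrict a path in `W` to a subset. -/
noncomputable def restr {W A : Set ℂ} {x y : W} (p : Path x y) (hp : ∀ t, (p t : ℂ) ∈ A) :
    Path (⟨x, by simpa using hp 0⟩ : A) ⟨y, by simpa using hp 1⟩ where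
  toFun t := ⟨p t, hp t⟩
  continuous_toFun := by fun_prop
  source' := by simp
  target' := by simp

theorem SCC.hom {W A : Set ℂ} (hA : SCC A) (hAW : A ⊆ W) {x y : W} (p q : Path x y)
    (hp : ∀ t, (p t : ℂ) ∈ A) (hq : ∀ t, (q t : ℂ) ∈ A) : p.Homotopic q := by
  have h := (hA _ _ (restr p hp) (restr q hq)).map ⟨Set.inclusion hAW, continuous_inclusion hAW⟩
  exact h

theorem vk_abs {X : Type*} [TopologicalSpace X] {A B : Set X} (hAo : IsOpen A) (hBo : IsOpen B)
    (hU : ∀ x, x ∈ A ∨ x ∈ B)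
    (hA : ∀ {x y : X} (p q : Path x y), (∀ t, p t ∈ A) → (∀ t, q t ∈ A) → p.Homotopic q)
    (hB : ∀ {x y : X} (p q : Path x y), (∀ t, p t ∈ B) → (∀ t, q t ∈ B) → p.Homotopic q)
    (cA : IsPathConnected A) (cB : IsPathConnected B) (cAB : IsPathConnected (A ∩ B))
    {x y : X} (p q : Path x y) : p.Homotopic q := by
  obtain ⟨x0, hx0⟩ := cAB.nonempty
  have hc : ∀ x, ∃ c : Path x0 x, (x ∈ A → ∀ t, c t ∈ A) ∧ (x ∈ B → ∀ t, c t ∈ B) := by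
    intro x
    by_cases h1 : x ∈ A
    · by_cases h2 : x ∈ B
      · obtain ⟨c, hc⟩ := cAB.joinedIn x0 hx0 x ⟨h1, h2⟩
        exact ⟨c, fun _ t => (hc t).1, fun _ t => (hc t).2⟩
      · obtain ⟨c, hc⟩ := cA.joinedIn x0 hx0.1 x h1
        exact ⟨c, fun _ t => hc t, fun h => absurd h h2⟩
    · obtain ⟨c, hc⟩ := cB.joinedIn x0 hx0.2 x ((hU x).resolve_left h1)
      exact ⟨c, fun h => absurd h h1, fun _ t => hc t⟩
  choose c hcA hcB using hc
  -- small paths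
  have hsmall : ∀ {x y : X} (r : Path x y), ((∀ t, r t ∈ A) ∨ (∀ t, r t ∈ B)) →
      Path.Homotopic.Quotient.mk (c y) = (Path.Homotopic.Quotient.mk (c x)).trans (.mk r) := by
    intro x y r hr
    rw [← Path.Homotopic.Quotient.mk_trans, Path.Homotopic.Quotient.eq]
    rcases hr with hr | hr
    · refine hA _ _ (hcA y (by simpa using hr 1)) ?_
      intro t
      have : ((c x).trans r) t ∈ range ((c x).trans r) := ⟨t, rfl⟩
      rw [Path.trans_range] at this
      rcases this with ⟨s, hs⟩ | ⟨s, hs⟩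
      · rw [← hs]; exact hcA x (by simpa using hr 0) s
      · rw [← hs]; exact hr s
    · refine hB _ _ (hcB y (by simpa using hr 1)) ?_
      intro t
      have : ((c x).trans r) t ∈ range ((c x).trans r) := ⟨t, rfl⟩
      rw [Path.trans_range] at this
      rcases this with ⟨s, hs⟩ | ⟨s, hs⟩
      · rw [← hs]; exact hcB x (by simpa using hr 0) s
      · rw [← hs]; exact hr s
  have key : ∀ {x y : X} (p : Path x y),
      Path.Homotopic.Quotient.mk (c y) = (Path.Homotopic.Quotient.mk (c x)).trans (.mk p) := by
    intro x y p
    have hloc : IsLocallyConstant (fun t : I => (Path.Homotopic.Quotient.mk (c (p t)) =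
        (Path.Homotopic.Quotient.mk (c (p 0))).trans (.mk (p.subpath 0 t)))) := by
      rw [IsLocallyConstant.iff_eventually_eq]
      intro t
      have hev : ∀ {O : Set X}, IsOpen O → p t ∈ O → ∀ᶠ s in 𝓝 t, ∀ u, p.subpath t s u ∈ O := by
        intro O hO ht
        have h1 : p ⁻¹' O ∈ 𝓝 t := (hO.preimage p.continuous).mem_nhds ht
        have h2 : Tendsto (fun s => uIcc t s) (𝓝 t) (𝓝 t).smallSets :=
          Tendsto.uIcc tendsto_const_nhds tendsto_id
        filter_upwards [h2.eventually (eventually_smallSets_subset.2 h1)] with s hs u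
        have : p.subpath t s u ∈ range (p.subpath t s) := ⟨u, rfl⟩
        rw [Path.range_subpath] at this
        obtain ⟨v, hv, hv'⟩ := this
        rw [← hv']; exact hs hv
      have : ∀ᶠ s in 𝓝 t, (∀ u, p.subpath t s u ∈ A) ∨ (∀ u, p.subpath t s u ∈ B) := by
        rcases hU (p t) with h | h
        · exact (hev hAo h).mono fun s hs => Or.inl hs
        · exact (hev hBo h).mono fun s hs => Or.inr hs
      filter_upwards [this] with s hs
      have e1 := hsmall _ hs
      have e2 : (Path.Homotopic.Quotient.mk (p.subpath 0 s)) =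
          (Path.Homotopic.Quotient.mk (p.subpath 0 t)).trans (.mk (p.subpath t s)) := by
        rw [← Path.Homotopic.Quotient.mk_trans, Path.Homotopic.Quotient.eq]
        exact ⟨(Path.Homotopy.subpathTransSubpath p 0 t s).symm⟩
      rw [e1, e2, ← Path.Homotopic.Quotient.trans_assoc]
      apply propext
      constructor
      · intro h
        have := congrArg (fun z => Path.Homotopic.Quotient.trans z
          (Path.Homotopic.Quotient.mk (p.subpath t s)).symm) h
        simpa [Path.Homotopic.Quotient.trans_assoc] using this
      · intro h; rw [h]
    have h01 := hloc.apply_eq_of_preconnectedSpace 0 1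
    have h1 : Path.Homotopic.Quotient.mk (c (p 1)) =
        (Path.Homotopic.Quotient.mk (c (p 0))).trans (.mk (p.subpath 0 1)) := by
      rw [← h01]; simp [Path.subpath_self]
    rw [Path.subpath_zero_one] at h1
    have gen : ∀ (a b : X) (ha : a = x) (hb : b = y),
      Path.Homotopic.Quotient.mk (c b) =
        (Path.Homotopic.Quotient.mk (c a)).trans (.mk (p.cast ha hb)) →
      Path.Homotopic.Quotient.mk (c y) = (Path.Homotopic.Quotient.mk (c x)).trans (.mk p) := by
      rintro a b rfl rfl h
      simpa using h
    exact gen _ _ p.source p.target h1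
  have e := (key p).symm.trans (key q)
  have e' := congrArg (fun z => Path.Homotopic.Quotient.trans
          (Path.Homotopic.Quotient.mk (c x)).symm z) e
  rw [← Path.Homotopic.Quotient.eq]
  simpa [← Path.Homotopic.Quotient.trans_assoc] using e'

theorem pc_val {W A : Set ℂ} (h : IsPathConnected A) (hAW : A ⊆ W) :
    IsPathConnected ((Subtype.val : W → ℂ) ⁻¹' A) := h.preimage_coe hAW

theorem SCC.vk_conn {A B : Set ℂ} (hAo : IsOpen A) (hBo : IsOpen B) (hA : SCC A) (hB : SCC B)
    (cA : IsPathConnected A) (cB : IsPathConnected B) (cAB : IsPathConnected (A ∩ B)) :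
    SCC (A ∪ B) := by
  intro x y p q
  refine vk_abs (A := Subtype.val ⁻¹' A) (B := Subtype.val ⁻¹' B)
    (hAo.preimage continuous_subtype_val) (hBo.preimage continuous_subtype_val)
    (fun x => x.2) ?_ ?_ ?_ ?_ ?_ p q
  · intro x y p q hp hq
    exact hA.hom subset_union_left p q hp hq
  · intro x y p q hp hq
    exact hB.hom subset_union_right p q hp hq
  · exact pc_val cA subset_union_left
  · exact pc_val cB subset_union_right
  · exact pc_val cAB (inter_subset_left.trans subset_union_left)

/-- a path stays in one of two disjoint open sets -/
theorem path_stay {X Y W : Set ℂ} (hX : IsOpen X) (hY : IsOpen Y) (hd : Disjoint X Y)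
    (hW : W ⊆ X ∪ Y) {x y : W} (p : Path x y) (hx : (x : ℂ) ∈ X) : ∀ t, (p t : ℂ) ∈ X := by
  have hc : IsPreconnected (range fun t => (p t : ℂ)) :=
    isPreconnected_range (by fun_prop)
  have := hc.subset_left_of_subset_union hX hY hd (by rintro _ ⟨t, rfl⟩; exact hW (p t).2)
    (show ((range fun t => (p t : ℂ)) ∩ X).Nonempty from ⟨x, ⟨0, by simp⟩, hx⟩)
  exact fun t => this ⟨t, rfl⟩

theorem SCC.disj {X Y : Set ℂ} (hX : IsOpen X) (hY : IsOpen Y) (hd : Disjoint X Y)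
    (sX : SCC X) (sY : SCC Y) : SCC (X ∪ Y) := by
  intro x y p q
  rcases x.2 with h | h
  · exact sX.hom subset_union_left p q (path_stay hX hY hd subset_rfl p h)
      (path_stay hX hY hd subset_rfl q h)
  · exact sY.hom subset_union_right p q (path_stay hY hX hd.symm (by rw [union_comm]) p h)
      (path_stay hY hX hd.symm (by rw [union_comm]) q h)

theorem SCC.sub {X Y : Set ℂ} (hX : IsOpen X) (hY : IsOpen Y) (hd : Disjoint X Y)
    (s : SCC (X ∪ Y)) : SCC X := by
  intro x y p q
  obtain ⟨F⟩ := s _ _ (restr (A := X ∪ Y) p (fun t => Or.inl (p t).2))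
    (restr (A := X ∪ Y) q (fun t => Or.inl (q t).2))
  have hF : ∀ t, (F t : ℂ) ∈ X := by
    have hc : IsPreconnected (range fun t => (F t : ℂ)) :=
      isPreconnected_range (by fun_prop)
    have := hc.subset_left_of_subset_union hX hY hd (by rintro _ ⟨t, rfl⟩; exact (F t).2)
      (show ((range fun t => (F t : ℂ)) ∩ X).Nonempty from ⟨x, ⟨(0, 0), by simp⟩, x.2⟩)
    exact fun t => this ⟨t, rfl⟩
  refine ⟨{ toFun := fun t => ⟨F t, hF t⟩
            map_zero_left := ?_
            map_one_left := ?_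
            prop' := ?_ }⟩
  · intro t; exact Subtype.ext (congrArg (fun z : (X ∪ Y : Set ℂ) => (z : ℂ)) (F.map_zero_left t))
  · intro t; exact Subtype.ext (congrArg (fun z : (X ∪ Y : Set ℂ) => (z : ℂ)) (F.map_one_left t))
  · intro t u hu
    ext1
    rcases hu with rfl | rfl <;> simp

/-- van Kampen, no connectedness of `A`, `B`. -/
theorem SCC.vk {A B : Set ℂ} (hAo : IsOpen A) (hBo : IsOpen B) (hA : SCC A) (hB : SCC B)
    (cAB : IsPathConnected (A ∩ B)) : SCC (A ∪ B) := by
  obtain ⟨x0, hx0⟩ := cAB.nonempty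
  set A' := connectedComponentIn A x0 with hA'
  set B' := connectedComponentIn B x0 with hB'
  have oA : IsOpen A' := hAo.connectedComponentIn
  have oB : IsOpen B' := hBo.connectedComponentIn
  have sA : A' ⊆ A := connectedComponentIn_subset _ _
  have sB : B' ⊆ B := connectedComponentIn_subset _ _
  have dop : ∀ {C : Set ℂ}, IsOpen C → IsOpen (C \ connectedComponentIn C x0) := by
    intro C hC
    rw [isOpen_iff_mem_nhds]
    rintro z ⟨hz, hz'⟩
    refine mem_of_superset (hC.connectedComponentIn.mem_nhds (mem_connectedComponentIn hz)) ?_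
    intro w hw
    refine ⟨connectedComponentIn_subset _ _ hw, fun hw' => hz' ?_⟩
    rw [connectedComponentIn_eq hw', ← connectedComponentIn_eq hw]
    exact mem_connectedComponentIn hz
  have iA : A ∩ B ⊆ A' := cAB.isConnected.isPreconnected.subset_connectedComponentIn hx0 inter_subset_left
  have iB : A ∩ B ⊆ B' := cAB.isConnected.isPreconnected.subset_connectedComponentIn hx0 inter_subset_right
  have eAB : A' ∩ B' = A ∩ B := Subset.antisymm (inter_subset_inter sA sB) (subset_inter iA iB)
  have uA : A' ∪ (A \ A') = A := union_sdiff_cancel sA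
  have uB : B' ∪ (B \ B') = B := union_sdiff_cancel sB
  have pA : IsPathConnected A' := (oA.isConnected_iff_isPathConnected).1
    (isConnected_connectedComponentIn_iff.2 hx0.1)
  have pB : IsPathConnected B' := (oB.isConnected_iff_isPathConnected).1
    (isConnected_connectedComponentIn_iff.2 hx0.2)
  have dA := dop hAo
  have dB := dop hBo
  have s1 : SCC (A' ∪ B') := by
    refine SCC.vk_conn oA oB ?_ ?_ pA pB (by rwa [eAB])
    · exact SCC.sub oA dA disjoint_sdiff_right (by rw [uA]; exact hA)
    · exact SCC.sub oB dB disjoint_sdiff_right (by rw [uB]; exact hB)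
  have s2 : SCC (A \ A') := SCC.sub dA oA disjoint_sdiff_left (by rw [union_comm, uA]; exact hA)
  have s3 : SCC (B \ B') := SCC.sub dB oB disjoint_sdiff_left (by rw [union_comm, uB]; exact hB)
  have : A ∪ B = (A' ∪ B') ∪ ((A \ A') ∪ (B \ B')) := by
    ext z; have := @sA z; have := @sB z; simp only [mem_union, Set.mem_sdiff]; tauto
  rw [this]
  refine SCC.disj (oA.union oB) (dA.union dB) ?_ s1 (SCC.disj dA dB ?_ s2 s3)
  · rw [Set.disjoint_left]
    rintro z (hz | hz) (h | h)
    · exact h.2 hz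
    · exact h.2 (iB ⟨sA hz, h.1⟩)
    · exact h.2 (iA ⟨h.1, sB hz⟩)
    · exact h.2 hz
  · rw [Set.disjoint_left]
    rintro z h1 h2
    exact h1.2 (iA ⟨h1.1, h2.1⟩)

theorem SCC.of_convex_comp {W : Set ℂ} (h : ∀ z ∈ W, Convex ℝ (connectedComponentIn W z)) :
    SCC W := by
  intro x y p q
  have hin : ∀ {y : W} (p : Path x y), ∀ t, (p t : ℂ) ∈ connectedComponentIn W x := by
    intro y p t
    have hc : IsPreconnected (range fun t => (p t : ℂ)) :=
      isPreconnected_range (by fun_prop)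
    exact hc.subset_connectedComponentIn ⟨0, by simp⟩ (by rintro _ ⟨t, rfl⟩; exact (p t).2) ⟨t, rfl⟩
  have hF : ∀ t : I × I, (1 - (t.1 : ℝ)) • (p t.2 : ℂ) + (t.1 : ℝ) • (q t.2 : ℂ) ∈ W := by
    intro t
    exact connectedComponentIn_subset _ _ (h x x.2 (hin p t.2) (hin q t.2)
      (by linarith [t.1.2.2]) t.1.2.1 (by ring))
  refine ⟨{ toFun := fun t => ⟨_, hF t⟩
            continuous_toFun := by fun_prop
            map_zero_left := ?_
            map_one_left := ?_
            prop' := ?_ }⟩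
  · intro t; ext1; simp
  · intro t; ext1; simp
  · intro t u hu
    ext1
    rcases hu with rfl | rfl <;> simp <;> ring

theorem SCC.of_convex {W : Set ℂ} (h : Convex ℝ W) : SCC W := by
  refine SCC.of_convex_comp fun z hz => ?_
  rwa [h.isPreconnected.connectedComponentIn hz]

end Ark

namespace Ark
open Set Topology Filter unitInterval

/-- hole-free sets -/
def HF (W : Set ℂ) : Prop := ∀ G : Set ℂ, IsOpen G → IsBounded G → frontier G ⊆ W → G ⊆ W

theorem const_of_exp_one {X : Type*} [TopologicalSpace X] {S : Set X} (hS : IsPreconnected S)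
    {f : X → ℂ} (hf : ContinuousOn f S) (h1 : ∀ s ∈ S, exp (f s) = 1) {s t : X} (hs : s ∈ S)
    (ht : t ∈ S) : f s = f t := by
  have h2 : ∀ s ∈ S, ∃ n : ℤ, f s = n * (2 * Real.pi * Complex.I) := fun s hs => exp_eq_one_iff.1 (h1 s hs)
  have him : ∀ s ∈ S, ∃ n : ℤ, f s = n * (2 * Real.pi * Complex.I) ∧ (f s).im = n * (2 * Real.pi) := by
    intro s hs
    obtain ⟨n, hn⟩ := h2 s hs
    exact ⟨n, hn, by rw [hn]; simp⟩
  have hpre : IsPreconnected ((fun x => (f x).im) '' S) :=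
    hS.image _ (Complex.continuous_im.comp_continuousOn hf)
  have key : ∀ {s t : X}, s ∈ S → t ∈ S → ¬ (f s).im < (f t).im := by
    intro s t hs ht hlt
    obtain ⟨n, -, hn⟩ := him s hs
    obtain ⟨m, -, hm⟩ := him t ht
    have hpi := Real.pi_pos
    have hnm : n < m := by
      rw [hn, hm] at hlt
      have : (n : ℝ) < m := by nlinarith
      exact_mod_cast this
    have hnm' : (n : ℝ) + 1 ≤ m := by exact_mod_cast hnm
    have hmem : (n : ℝ) * (2 * Real.pi) + Real.pi ∈ ((fun x => (f x).im) '' S) := by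
      refine hpre.ordConnected.out ⟨s, hs, rfl⟩ ⟨t, ht, rfl⟩ ⟨?_, ?_⟩
      · simp only [hn]; linarith
      · simp only [hm]; nlinarith
    obtain ⟨r, hr, hr'⟩ := hmem
    obtain ⟨l, -, hl⟩ := him r hr
    simp only [hl] at hr'
    have : (l : ℝ) * 2 = n * 2 + 1 := by
      have h3 : Real.pi * ((l : ℝ) * 2) = Real.pi * (n * 2 + 1) := by linarith
      exact mul_left_cancel₀ hpi.ne' h3
    have : l * 2 = n * 2 + 1 := by exact_mod_cast this
    omega
  have heq : (f s).im = (f t).im := le_antisymm (not_lt.1 (key ht hs)) (not_lt.1 (key hs ht))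
  obtain ⟨n, hn, hn'⟩ := him s hs
  obtain ⟨m, hm, hm'⟩ := him t ht
  rw [hn', hm'] at heq
  have : (n : ℝ) = m := mul_right_cancel₀ (by positivity) heq
  have : n = m := by exact_mod_cast this
  rw [hn, hm, this]

theorem frontier_comp {O : Set ℂ} (hO : IsOpen O) (a : ℂ) :
    frontier (connectedComponentIn O a) ⊆ Oᶜ := by
  intro w hw hwO
  have hop := hO.connectedComponentIn (x := w)
  rw [hO.connectedComponentIn.frontier_eq] at hw
  obtain ⟨v, hv1, hv2⟩ := mem_closure_iff.1 hw.1 _ hop (mem_connectedComponentIn hwO)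
  apply hw.2
  rw [connectedComponentIn_eq hv2, ← connectedComponentIn_eq hv1]
  exact mem_connectedComponentIn hwO

theorem slit_of_close {z : ℂ} (h : ‖z‖ < 1) : 1 + z ∈ slitPlane := by
  left
  have := (abs_le.1 (abs_re_le_norm z)).1
  simp; linarith

/-- a continuous logarithm of `w - a` on `T`. -/
def HasLog (T : Set ℂ) (a : ℂ) : Prop :=
  ∃ g : ℂ → ℂ, ContinuousOn g T ∧ ∀ w ∈ T, exp (g w) = w - a

theorem HasLog.move {T : Set ℂ} {a a' : ℂ} (h : HasLog T a) (hd : ∀ w ∈ T, ‖a - a'‖ < ‖w - a‖) :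
    HasLog T a' := by
  obtain ⟨g, hg, hg'⟩ := h
  have hne : ∀ w ∈ T, w - a ≠ 0 := fun w hw => norm_pos_iff.1 ((norm_nonneg _).trans_lt (hd w hw))
  have hsl : ∀ w ∈ T, 1 + (a - a') / (w - a) ∈ slitPlane := by
    intro w hw
    apply slit_of_close
    rw [norm_div, div_lt_one (norm_pos_iff.2 (hne w hw))]
    exact hd w hw
  refine ⟨fun w => g w + log (1 + (a - a') / (w - a)), ?_, ?_⟩
  · refine hg.add (ContinuousOn.clog ?_ hsl)
    exact continuousOn_const.add (continuousOn_const.div (by fun_prop) hne)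
  · intro w hw
    rw [exp_add, hg' w hw, exp_log (slitPlane_ne_zero (hsl w hw))]
    have := hne w hw
    field_simp
    ring

theorem hasLog_of_unbounded {T : Set ℂ} (hT : IsCompact T) {a : ℂ} (ha : a ∉ T)
    (hb : ¬ IsBounded (connectedComponentIn Tᶜ a)) : HasLog T a := by
  obtain ⟨R, hR⟩ := hT.isBounded.exists_norm_le
  have hfar : ∃ b ∈ connectedComponentIn Tᶜ a, HasLog T b := by
    by_contra hcon
    push Not at hcon
    apply hb
    rw [isBounded_iff_forall_norm_le]
    refine ⟨max R 0, fun b hbC => ?_⟩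
    by_contra hlt
    push Not at hlt
    apply hcon b hbC
    have hb0 : 0 < ‖b‖ := (le_max_right _ _).trans_lt hlt
    have hbn : b ≠ 0 := norm_pos_iff.1 hb0
    have hsl : ∀ w ∈ T, 1 + (-w / b) ∈ slitPlane := by
      intro w hw
      apply slit_of_close
      rw [norm_div, div_lt_one hb0, norm_neg]
      exact (hR w hw).trans_lt ((le_max_left _ _).trans_lt hlt)
    refine ⟨fun w => log (-b) + log (1 + (-w / b)), ?_, ?_⟩
    · exact continuousOn_const.add (ContinuousOn.clog (by fun_prop) hsl)
    · intro w hw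
      rw [exp_add, exp_log (neg_ne_zero.2 hbn), exp_log (slitPlane_ne_zero (hsl w hw))]
      field_simp
      ring
  obtain ⟨b, hbC, hbL⟩ := hfar
  set C := connectedComponentIn Tᶜ a
  have hCT : C ⊆ Tᶜ := connectedComponentIn_subset _ _
  have hlc : ∀ c ∈ C, ∀ᶠ c' in 𝓝 c, (HasLog T c' ↔ HasLog T c) := by
    intro c hc
    obtain ⟨ε, hε, hball⟩ := Metric.isOpen_iff.1 hT.isClosed.isOpen_compl c (hCT hc)
    filter_upwards [Metric.ball_mem_nhds c (half_pos hε)] with c' hc'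
    rw [Metric.mem_ball, dist_eq_norm] at hc'
    have hw : ∀ w ∈ T, ε ≤ ‖w - c‖ := by
      intro w hw
      by_contra hlt
      exact hball (by rw [Metric.mem_ball, dist_eq_norm]; exact not_le.1 hlt) hw
    constructor
    · intro h
      refine h.move fun w hwT => ?_
      have h1 := hw w hwT
      have h2 : ‖w - c‖ ≤ ‖w - c'‖ + ‖c' - c‖ := by
        simpa using norm_add_le (w - c') (c' - c)
      linarith
    · intro h
      refine h.move fun w hwT => ?_
      have h1 := hw w hwT
      rw [norm_sub_rev]; linarith
  have hpc : IsPreconnected C := isPreconnected_connectedComponentIn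
  have haC : a ∈ C := mem_connectedComponentIn ha
  by_contra hno
  have ho1 : IsOpen {c | ∀ᶠ c' in 𝓝 c, HasLog T c'} := isOpen_setOfPred_eventually_nhds
  have ho2 : IsOpen {c | ∀ᶠ c' in 𝓝 c, ¬ HasLog T c'} := isOpen_setOfPred_eventually_nhds
  obtain ⟨c, -, h1, h2⟩ := hpc _ _ ho1 ho2 (by
    intro c hc
    by_cases h : HasLog T c
    · left; exact (hlc c hc).mono fun c' h' => h'.2 h
    · right; exact (hlc c hc).mono fun c' h' h2 => h (h'.1 h2))
    ⟨b, hbC, (hlc b hbC).mono fun c' h' => h'.2 hbL⟩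
    ⟨a, haC, (hlc a haC).mono fun c' h' h2 => hno (h'.1 h2)⟩
  exact h2.self_of_nhds h1.self_of_nhds

theorem HF.hasLog {W T : Set ℂ} (hW : HF W) (hT : IsCompact T) (hTW : T ⊆ W) {a : ℂ}
    (ha : a ∉ W) : HasLog T a := by
  have haT : a ∉ T := fun h => ha (hTW h)
  refine hasLog_of_unbounded hT haT fun hb => ha ?_
  refine hW _ hT.isClosed.isOpen_compl.connectedComponentIn hb ?_ (mem_connectedComponentIn haT)
  refine (frontier_comp hT.isClosed.isOpen_compl a).trans ?_
  rwa [compl_compl]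

theorem im_quot (ζ : ℂ) (k s0 s1 : ℝ) :
    ((ζ - ⟨k, s0⟩) / (ζ - ⟨k, s1⟩)).im = (ζ.re - k) * (s1 - s0) / normSq (ζ - ⟨k, s1⟩) := by
  rw [div_im]; simp only [sub_re, sub_im]; ring

theorem re_quot (ζ : ℂ) (k s0 s1 : ℝ) : ((ζ - ⟨k, s0⟩) / (ζ - ⟨k, s1⟩)).re =
    ((ζ.re - k) ^ 2 + (ζ.im - s0) * (ζ.im - s1)) / normSq (ζ - ⟨k, s1⟩) := by
  rw [div_re]; simp only [sub_re, sub_im]; ring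

theorem sep {W : Set ℂ} (hW : HF W) {k s0 s1 : ℝ} (hs : s0 < s1)
    (ha : (⟨k, s0⟩ : ℂ) ∉ W) (hb : (⟨k, s1⟩ : ℂ) ∉ W) {z w : ℂ}
    (p : Path z w) (hp : ∀ t, p t ∈ W) (hpg : ∀ t, ¬ ((p t).re = k ∧ s0 < (p t).im ∧ (p t).im < s1))
    (hz : z.re < k) (hw : k < w.re) (hseg : segment ℝ z w ⊆ W)
    (hseg' : ∀ ζ ∈ segment ℝ z w, s0 < ζ.im ∧ ζ.im < s1) : False := by
  set u : ℂ → ℂ := fun ζ => (ζ - ⟨k, s0⟩) / (ζ - ⟨k, s1⟩) with hu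
  set T := range p ∪ segment ℝ z w with hTdef
  have hT : IsCompact T := (isCompact_range p.continuous).union (by
    rw [segment_eq_image]
    exact isCompact_Icc.image (by fun_prop))
  have hTW : T ⊆ W := union_subset (by rintro _ ⟨t, rfl⟩; exact hp t) hseg
  obtain ⟨ga, ca, ea⟩ := hW.hasLog hT hTW ha
  obtain ⟨gb, cb, eb⟩ := hW.hasLog hT hTW hb
  have hneb : ∀ ζ ∈ T, ζ - (⟨k, s1⟩ : ℂ) ≠ 0 := fun ζ hζ h => hb (by
    rw [← sub_eq_zero.1 h]; exact hTW hζ)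
  have hnea : ∀ ζ ∈ T, ζ - (⟨k, s0⟩ : ℂ) ≠ 0 := fun ζ hζ h => ha (by
    rw [← sub_eq_zero.1 h]; exact hTW hζ)
  have hun : ∀ ζ ∈ T, u ζ ≠ 0 := fun ζ hζ => div_ne_zero (hnea ζ hζ) (hneb ζ hζ)
  have cu : ContinuousOn u T := ContinuousOn.div (by fun_prop) (by fun_prop) hneb
  have hns : ∀ ζ ∈ T, 0 < normSq (ζ - (⟨k, s1⟩ : ℂ)) := fun ζ hζ => normSq_pos.2 (hneb ζ hζ)
  have eD : ∀ ζ ∈ T, exp (ga ζ - gb ζ) = u ζ := by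
    intro ζ hζ; rw [exp_sub, ea ζ hζ, eb ζ hζ]
  have hs1 : ∀ ζ ∈ range p, u ζ ∈ slitPlane := by
    rintro ζ ⟨t, rfl⟩
    have hmem : p t ∈ T := Or.inl ⟨t, rfl⟩
    have hn := hns _ hmem
    by_cases hre : (p t).re = k
    · left
      simp only [hu]
      rw [re_quot]
      apply div_pos _ hn
      have h1 := hpg t
      have h2 : (p t).im ≠ s0 := fun h => hnea _ hmem (by apply Complex.ext <;> simp [hre, h])
      have h3 : (p t).im ≠ s1 := fun h => hneb _ hmem (by apply Complex.ext <;> simp [hre, h])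
      rw [hre]
      rcases lt_or_gt_of_ne h2 with h2 | h2
      · nlinarith
      · have : s1 < (p t).im := lt_of_le_of_ne (not_lt.1 fun h => h1 ⟨hre, h2, h⟩) h3.symm
        nlinarith
    · right
      simp only [hu]
      rw [im_quot]
      exact div_ne_zero (mul_ne_zero (sub_ne_zero.2 hre) (sub_pos.2 hs).ne') hn.ne'
  have hs2 : ∀ ζ ∈ segment ℝ z w, -u ζ ∈ slitPlane := by
    intro ζ hζ
    have hn := hns _ (Or.inr hζ)
    obtain ⟨h1, h2⟩ := hseg' ζ hζ
    by_cases hre : ζ.re = k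
    · left
      simp only [hu]
      rw [neg_re, re_quot, hre, ← neg_div]
      apply div_pos _ hn
      nlinarith
    · right
      simp only [hu]
      rw [neg_im, im_quot]
      exact neg_ne_zero.2 (div_ne_zero (mul_ne_zero (sub_ne_zero.2 hre) (sub_pos.2 hs).ne') hn.ne')
  have zp : z ∈ range p := ⟨0, by simp⟩
  have wp : w ∈ range p := ⟨1, by simp⟩
  have zs : z ∈ segment ℝ z w := left_mem_segment ..
  have ws : w ∈ segment ℝ z w := right_mem_segment ..
  have c1 := const_of_exp_one (isPreconnected_range p.continuous)
    (f := fun ζ => ga ζ - gb ζ - log (u ζ))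
    (((ca.sub cb).mono subset_union_left).sub ((cu.mono subset_union_left).clog hs1))
    (by
      intro ζ hζ
      rw [exp_sub, eD ζ (Or.inl hζ), exp_log (hun ζ (Or.inl hζ)), div_self (hun ζ (Or.inl hζ))]) zp wp
  have c2 := const_of_exp_one (convex_segment (𝕜 := ℝ) z w).isPreconnected
    (f := fun ζ => ga ζ - gb ζ - log (-u ζ) - Real.pi * Complex.I)
    ((((ca.sub cb).mono subset_union_right).sub
      ((cu.mono subset_union_right).neg.clog hs2)).sub continuousOn_const)
    (fun ζ hζ => by
      have hh := hun ζ (Or.inr hζ)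
      rw [exp_sub, exp_sub, eD ζ (Or.inr hζ), exp_log (neg_ne_zero.2 hh), exp_pi_mul_I]
      field_simp) zs ws
  have iz : (u z).im < 0 := by
    simp only [hu]
    rw [im_quot]
    exact div_neg_of_neg_of_pos (mul_neg_of_neg_of_pos (by linarith) (by linarith))
      (hns z (Or.inl zp))
  have iw : 0 < (u w).im := by
    simp only [hu]
    rw [im_quot]
    exact div_pos (mul_pos (by linarith) (by linarith)) (hns w (Or.inl wp))
  have lz : (log (-u z)).im = (log (u z)).im + Real.pi := by
    rw [log_im, log_im, arg_neg_eq_arg_add_pi_of_im_neg iz]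
  have lw : (log (-u w)).im = (log (u w)).im - Real.pi := by
    rw [log_im, log_im, arg_neg_eq_arg_sub_pi_of_im_pos iw]
  have d1 := congrArg Complex.im c1
  have d2 := congrArg Complex.im c2
  simp only [sub_im] at d1 d2
  have := Real.pi_pos
  linarith

end Ark

namespace Ark
open Set Topology Filter unitInterval

def gate (g : ℝ × ℝ × ℝ) : Set ℂ := {z | z.re = g.1 ∧ g.2.1 < z.im ∧ z.im < g.2.2}

def box (g : ℝ × ℝ × ℝ) : Set ℂ :=
  {z | (g.1 - 1 < z.re ∧ z.re < g.1 + 1) ∧ g.2.1 < z.im ∧ z.im < g.2.2}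

/-- `g` is a gate of `W`. -/
def IsGate (W : Set ℂ) (g : ℝ × ℝ × ℝ) : Prop :=
  g.2.1 < g.2.2 ∧ (⟨g.1, g.2.1⟩ : ℂ) ∉ W ∧ (⟨g.1, g.2.2⟩ : ℂ) ∉ W ∧ box g ⊆ W

theorem gate_sub_box (g) : gate g ⊆ box g := fun z hz => ⟨⟨by linarith [hz.1], by linarith [hz.1]⟩, hz.2⟩

theorem isOpen_diff_gate {W : Set ℂ} (hW : IsOpen W) {g : ℝ × ℝ × ℝ} (hg : IsGate W g) :
    IsOpen (W \ gate g) := by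
  have : W \ gate g = W ∩ {z | z.re = g.1 ∧ g.2.1 ≤ z.im ∧ z.im ≤ g.2.2}ᶜ := by
    ext z
    constructor
    · rintro ⟨h1, h2⟩
      refine ⟨h1, fun h => h2 ⟨h.1, lt_of_le_of_ne h.2.1 ?_, lt_of_le_of_ne h.2.2 ?_⟩⟩
      · intro h3
        have e : (⟨g.1, g.2.1⟩ : ℂ) = z := Complex.ext h.1.symm h3
        exact hg.2.1 (by rw [e]; exact h1)
      · intro h3
        have e : (⟨g.1, g.2.2⟩ : ℂ) = z := Complex.ext h.1.symm h3.symm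
        exact hg.2.2.1 (by rw [e]; exact h1)
    · rintro ⟨h1, h2⟩
      exact ⟨h1, fun h => h2 ⟨h.1, h.2.1.le, h.2.2.le⟩⟩
  rw [this]
  refine hW.inter (IsClosed.isOpen_compl (self := ?_))
  exact (isClosed_eq continuous_re continuous_const).inter
    ((isClosed_le continuous_const continuous_im).inter (isClosed_le continuous_im continuous_const))

theorem convex_re_im {A B : Set ℝ} (hA : Convex ℝ A) (hB : Convex ℝ B) :
    Convex ℝ {z : ℂ | z.re ∈ A ∧ z.im ∈ B} :=
  (hA.linear_preimage reLm).inter (hB.linear_preimage imLm)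

theorem convex_gate (g) : Convex ℝ (gate g) := by
  have := convex_re_im (convex_singleton (𝕜 := ℝ) g.1) (convex_Ioo g.2.1 g.2.2)
  exact this

theorem convex_box (g) : Convex ℝ (box g) := by
  have := convex_re_im (convex_Ioo (g.1 - 1) (g.1 + 1)) (convex_Ioo g.2.1 g.2.2)
  exact this

theorem convex_boxL (g : ℝ × ℝ × ℝ) : Convex ℝ (box g ∩ {z | z.re < g.1}) :=
  (convex_box g).inter ((convex_Iio g.1).linear_preimage reLm)

theorem convex_boxR (g : ℝ × ℝ × ℝ) : Convex ℝ (box g ∩ {z | g.1 < z.re}) :=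
  (convex_box g).inter ((convex_Ioi g.1).linear_preimage reLm)

theorem isOpen_box (g) : IsOpen (box g) :=
  ((isOpen_lt continuous_const continuous_re).inter (isOpen_lt continuous_re continuous_const)).inter
    ((isOpen_lt continuous_const continuous_im).inter (isOpen_lt continuous_im continuous_const))

theorem HF.diff_gate {W : Set ℂ} (hW : HF W) {g : ℝ × ℝ × ℝ} (hg : IsGate W g) :
    HF (W \ gate g) := by
  intro G hG hb hfr
  have hGW : G ⊆ W := hW G hG hb (hfr.trans sdiff_subset)
  intro z hz
  refine ⟨hGW hz, fun hzg => ?_⟩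
  -- the gate lies in G
  have hsub : gate g ⊆ G := by
    refine (convex_gate g).isPreconnected.subset_of_closure_inter_subset hG ⟨z, hzg, hz⟩ ?_
    rintro w ⟨hw, hwg⟩
    by_contra hwG
    exact (hfr (by rw [hG.frontier_eq]; exact ⟨hw, hwG⟩)).2 hwg
  have hcl : closure G ⊆ W := by
    rw [closure_eq_self_union_frontier]
    exact union_subset hGW (hfr.trans sdiff_subset)
  apply hg.2.1
  apply hcl
  apply closure_mono hsub
  have ht : Tendsto (fun t : ℝ => (⟨g.1, t⟩ : ℂ)) (𝓝[>] g.2.1) (𝓝 ⟨g.1, g.2.1⟩) := by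
    have : Continuous (fun t : ℝ => (⟨g.1, t⟩ : ℂ)) := by
      have : (fun t : ℝ => (⟨g.1, t⟩ : ℂ)) = fun t : ℝ => (g.1 : ℂ) + t * Complex.I := by
        ext t; simp [Complex.ext_iff]
      rw [this]; fun_prop
    exact (this.tendsto _).mono_left nhdsWithin_le_nhds
  refine mem_closure_of_tendsto ht ?_
  filter_upwards [Ioo_mem_nhdsGT hg.1] with t ht
  exact ⟨rfl, ht.1, ht.2⟩

theorem step {W : Set ℂ} (hWo : IsOpen W) (hW : HF W) {g : ℝ × ℝ × ℝ} (hg : IsGate W g)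
    (hs : SCC (W \ gate g)) : SCC W := by
  have hWo' := isOpen_diff_gate hWo hg
  obtain ⟨h01, ha, hb, hbox⟩ := hg
  set m : ℝ := (g.2.1 + g.2.2) / 2 with hm
  set cR : ℂ := ⟨g.1 + 1 / 2, m⟩ with hcR
  set cL : ℂ := ⟨g.1 - 1 / 2, m⟩ with hcL
  have cRm : cR ∈ box g ∩ {z | g.1 < z.re} := by
    refine ⟨⟨⟨?_, ?_⟩, ?_, ?_⟩, ?_⟩ <;> simp [hcR, hm] <;> linarith
  have cLm : cL ∈ box g ∩ {z | z.re < g.1} := by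
    refine ⟨⟨⟨?_, ?_⟩, ?_, ?_⟩, ?_⟩ <;> simp [hcL, hm] <;> linarith
  set W' := W \ gate g with hW'
  have subR : box g ∩ {z | g.1 < z.re} ⊆ W' := fun z hz => ⟨hbox hz.1, fun h => hz.2.ne' h.1⟩
  have subL : box g ∩ {z | z.re < g.1} ⊆ W' := fun z hz => ⟨hbox hz.1, fun h => hz.2.ne h.1⟩
  set R := connectedComponentIn W' cR with hR
  have oR : IsOpen R := hWo'.connectedComponentIn
  have sR : R ⊆ W' := connectedComponentIn_subset _ _
  have oL : IsOpen (W' \ R) := by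
    rw [isOpen_iff_mem_nhds]
    rintro z ⟨hz, hz'⟩
    refine mem_of_superset (hWo'.connectedComponentIn.mem_nhds (mem_connectedComponentIn hz)) ?_
    intro w hw
    refine ⟨connectedComponentIn_subset _ _ hw, fun hw' => hz' ?_⟩
    rw [hR, connectedComponentIn_eq hw', ← connectedComponentIn_eq hw]
    exact mem_connectedComponentIn hz
  have NR : box g ∩ {z | g.1 < z.re} ⊆ R :=
    (convex_boxR g).isPreconnected.subset_connectedComponentIn cRm subR
  have hpcR : IsPathConnected R := (oR.isConnected_iff_isPathConnected).1
    (isConnected_connectedComponentIn_iff.2 (subR cRm))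
  have NL : box g ∩ {z | z.re < g.1} ⊆ W' \ R := by
    intro z hz
    refine ⟨subL hz, fun hzR => ?_⟩
    obtain ⟨p, hp⟩ := hpcR.joinedIn z hzR cR (NR cRm)
    have hseg : segment ℝ z cR ⊆ box g := (convex_box g).segment_subset hz.1 cRm.1
    exact sep hW h01 ha hb p (fun t => (sR (hp t)).1) (fun t => (sR (hp t)).2) hz.2 cRm.2
      (hseg.trans hbox) (fun ζ hζ => (hseg hζ).2)
  have uLR : (W' \ R) ∪ R = W' := by rw [union_comm]; exact union_sdiff_cancel sR
  have sccL : SCC (W' \ R) := SCC.sub oL oR disjoint_sdiff_left (by rw [uLR]; exact hs)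
  have sccR : SCC R := SCC.sub oR oL disjoint_sdiff_right (by rw [union_comm, uLR]; exact hs)
  have sccN : SCC (box g) := SCC.of_convex (convex_box g)
  have tri : ∀ z ∈ box g, z ∈ gate g ∨ z.re < g.1 ∨ g.1 < z.re := by
    intro z hz
    rcases lt_trichotomy z.re g.1 with h | h | h
    · exact Or.inr (Or.inl h)
    · exact Or.inl ⟨h, hz.2⟩
    · exact Or.inr (Or.inr h)
  have eL : (W' \ R) ∩ box g = box g ∩ {z | z.re < g.1} := by
    ext z
    constructor
    · rintro ⟨h1, h2⟩
      rcases tri z h2 with h | h | h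
      · exact absurd h h1.1.2
      · exact ⟨h2, h⟩
      · exact absurd (NR ⟨h2, h⟩) h1.2
    · intro h; exact ⟨NL h, h.1⟩
  have eR : R ∩ box g = box g ∩ {z | g.1 < z.re} := by
    ext z
    constructor
    · rintro ⟨h1, h2⟩
      rcases tri z h2 with h | h | h
      · exact absurd h (sR h1).2
      · exact absurd h1 (NL ⟨h2, h⟩).2
      · exact ⟨h2, h⟩
    · intro h; exact ⟨NR h, h.1⟩
  have s1 : SCC ((W' \ R) ∪ box g) := SCC.vk oL (isOpen_box g) sccL sccN
    (by rw [eL]; exact (convex_boxL g).isPathConnected ⟨_, cLm⟩)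
  have s2 : SCC (R ∪ box g) := SCC.vk oR (isOpen_box g) sccR sccN
    (by rw [eR]; exact (convex_boxR g).isPathConnected ⟨_, cRm⟩)
  have e3 : ((W' \ R) ∪ box g) ∩ (R ∪ box g) = box g := by
    rw [← inter_union_distrib_right, sdiff_inter_self, empty_union]
  have s3 := SCC.vk (oL.union (isOpen_box g)) (oR.union (isOpen_box g)) s1 s2
    (by rw [e3]; exact (convex_box g).isPathConnected ⟨_, cRm.1⟩)
  have e4 : ((W' \ R) ∪ box g) ∪ (R ∪ box g) = W := by
    apply Subset.antisymm
    · refine union_subset (union_subset ?_ hbox) (union_subset ?_ hbox)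
      · exact fun z hz => hz.1.1
      · exact fun z hz => (sR hz).1
    · intro z hz
      by_cases h : z ∈ gate g
      · exact Or.inl (Or.inr (gate_sub_box g h))
      · by_cases h' : z ∈ R
        · exact Or.inr (Or.inl h')
        · exact Or.inl (Or.inl ⟨⟨hz, h⟩, h'⟩)
  rwa [e4] at s3

theorem gates (s : Finset (ℝ × ℝ × ℝ)) : ∀ W : Set ℂ, IsOpen W → HF W → (∀ g ∈ s, IsGate W g) →
    (∀ g ∈ s, ∀ g' ∈ s, g ≠ g' → Disjoint (box g) (gate g')) →
    SCC (W \ ⋃ g ∈ s, gate g) → SCC W := by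
  classical
  induction s using Finset.induction_on with
  | empty => intro W _ _ _ _ h; simpa using h
  | insert g s hgs ih =>
    intro W hWo hW hg hd hs
    have hgg := hg g (Finset.mem_insert_self _ _)
    refine step hWo hW hgg ?_
    refine ih _ (isOpen_diff_gate hWo hgg) (hW.diff_gate hgg) ?_ ?_ ?_
    · intro g' hg'
      obtain ⟨h1, h2, h3, h4⟩ := hg g' (Finset.mem_insert_of_mem hg')
      refine ⟨h1, fun h => h2 h.1, fun h => h3 h.1, fun z hz => ⟨h4 hz, fun h => ?_⟩⟩
      have hne : g' ≠ g := fun h => hgs (h ▸ hg')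
      exact Set.disjoint_left.1 (hd g' (Finset.mem_insert_of_mem hg') g (Finset.mem_insert_self _ _) hne)
        hz h
    · intro g' hg' g'' hg'' hne
      exact hd _ (Finset.mem_insert_of_mem hg') _ (Finset.mem_insert_of_mem hg'') hne
    · convert hs using 1
      rw [Finset.set_biUnion_insert, sdiff_sdiff]

/-- closed unit grid square -/
def Q (m n : ℤ) : Set ℂ := {z | ((m : ℝ) ≤ z.re ∧ z.re ≤ m + 1) ∧ (n : ℝ) ≤ z.im ∧ z.im ≤ n + 1}

theorem convex_Q (m n) : Convex ℝ (Q m n) := by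
  have := convex_re_im (convex_Icc (m : ℝ) (m + 1)) (convex_Icc (n : ℝ) (n + 1))
  exact this

/-- the union of good squares, interior -/
def GW (V : Set ℂ) : Set ℂ := {z | ∀ m n : ℤ, z ∈ Q m n → Q m n ⊆ V}

theorem exists_Q (z : ℂ) : ∃ m n : ℤ, z ∈ Q m n :=
  ⟨⌊z.re⌋, ⌊z.im⌋, ⟨Int.floor_le _, (Int.lt_floor_add_one _).le⟩, Int.floor_le _,
    (Int.lt_floor_add_one _).le⟩

theorem GW_sub (V) : GW V ⊆ V := by
  intro z hz
  obtain ⟨m, n, h⟩ := exists_Q z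
  exact hz m n h h

theorem isOpen_GW (V) : IsOpen (GW V) := by
  rw [isOpen_iff_mem_nhds]
  intro z hz
  have h1 : ∀ x : ℝ, ∀ᶠ x' in 𝓝 x, ∀ m : ℤ, ((m : ℝ) ≤ x' ∧ x' ≤ m + 1) → ((m : ℝ) ≤ x ∧ x ≤ m + 1) := by
    intro x
    have e1 : ∀ᶠ x' in 𝓝 x, x' < (⌊x⌋ : ℝ) + 1 := gt_mem_nhds (Int.lt_floor_add_one x)
    have e2 : ∀ᶠ x' in 𝓝 x, (⌈x⌉ : ℝ) - 1 < x' := lt_mem_nhds (by linarith [Int.ceil_lt_add_one x])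
    filter_upwards [e1, e2] with x' h1 h2 m hm
    have a1 : (m : ℝ) < ⌊x⌋ + 1 := by linarith
    have a2 : (⌈x⌉ : ℝ) < m + 1 + 1 := by linarith
    have b1 : m ≤ ⌊x⌋ := Int.lt_add_one_iff.1 (by exact_mod_cast a1)
    have b2 : ⌈x⌉ ≤ m + 1 := Int.lt_add_one_iff.1 (by exact_mod_cast a2)
    refine ⟨Int.le_floor.1 b1, ?_⟩
    have := Int.ceil_le.1 b2
    push_cast at this; exact this
  filter_upwards [Complex.continuous_re.continuousAt.eventually (h1 z.re),
    Complex.continuous_im.continuousAt.eventually (h1 z.im)] with w hw1 hw2 m n hw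
  exact hz m n ⟨hw1 m hw.1, hw2 n hw.2⟩

theorem HF.GW {V : Set ℂ} (hV : HF V) : HF (GW V) := by
  intro G hG hb hfr z hz m n hzQ
  have hGV := hV G hG hb (hfr.trans (GW_sub V))
  by_contra hQ
  apply hQ
  refine Subset.trans ?_ hGV
  refine (convex_Q m n).isPreconnected.subset_of_closure_inter_subset hG ⟨z, hzQ, hz⟩ ?_
  rintro w ⟨hw, hwQ⟩
  by_contra hwG
  exact hQ (hfr (by rw [hG.frontier_eq]; exact ⟨hw, hwG⟩) m n hwQ)

end Ark

namespace Ark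
open Set Topology Filter unitInterval

theorem GW_mono {V : Set ℂ} {z w : ℂ} (hz : z ∈ GW V) (h : ∀ m n : ℤ, w ∈ Q m n → z ∈ Q m n) :
    w ∈ GW V := fun m n hw => hz m n (h m n hw)

/-- integral gates -/
def IG (W : Set ℂ) (k i j : ℤ) : Prop :=
  i < j ∧ (⟨k, i⟩ : ℂ) ∉ W ∧ (⟨k, j⟩ : ℂ) ∉ W ∧ ∀ y : ℝ, i < y → y < j → (⟨k, y⟩ : ℂ) ∈ W

theorem IG.isGate {V : Set ℂ} {k i j : ℤ} (h : IG (GW V) k i j) : IsGate (GW V) (k, i, j) := by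
  obtain ⟨h1, h2, h3, h4⟩ := h
  refine ⟨Int.cast_lt.2 h1, h2, h3, ?_⟩
  rintro z ⟨⟨a, b⟩, c, d⟩
  dsimp only at a b c d
  refine GW_mono (h4 z.im c d) ?_
  rintro m n ⟨⟨e1, e2⟩, e3⟩
  have f1 : (m : ℝ) < k + 1 := by linarith
  have f2 : (k : ℝ) < m + 1 + 1 := by linarith
  have g1 : m < k + 1 := by exact_mod_cast f1
  have g2 : k < m + 1 + 1 := by exact_mod_cast f2
  have g1' : m ≤ k := by omega
  have g2' : k ≤ m + 1 := by omega
  have g3 : (m : ℝ) ≤ k := by exact_mod_cast g1'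
  have g4 : (k : ℝ) ≤ m + 1 := by exact_mod_cast g2'
  exact ⟨⟨g3, g4⟩, e3⟩

theorem IG.cover {V : Set ℂ} {M : ℝ} (hM : ∀ z ∈ V, |z.re| < M ∧ |z.im| < M) {z : ℂ}
    (hz : z ∈ GW V) {k : ℤ} (hk : z.re = k) : ∃ i j : ℤ, IG (GW V) k i j ∧ i < z.im ∧ z.im < j := by
  have hbig : ∀ n : ℤ, M ≤ |(n : ℝ)| → (⟨k, n⟩ : ℂ) ∉ GW V := fun n hn h =>
    absurd (hM _ (GW_sub V h)).2 (by simpa using hn)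
  have hzM := (hM _ (GW_sub V hz)).2
  rw [abs_lt] at hzM
  obtain ⟨i, ⟨hi1, hi2⟩, hi3⟩ := Int.exists_greatest_of_bdd (P := fun n : ℤ => (n : ℝ) ≤ z.im ∧ (⟨k, n⟩ : ℂ) ∉ GW V)
    ⟨⌊z.im⌋, fun n hn => Int.le_floor.2 hn.1⟩ ⟨⌊-M⌋, by
      have := Int.floor_le (-M)
      exact ⟨by linarith, hbig _ (le_abs.2 (Or.inr (by linarith)))⟩⟩
  obtain ⟨j, ⟨hj1, hj2⟩, hj3⟩ := Int.exists_least_of_bdd (P := fun n : ℤ => z.im ≤ (n : ℝ) ∧ (⟨k, n⟩ : ℂ) ∉ GW V)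
    ⟨⌈z.im⌉, fun n hn => Int.ceil_le.2 hn.1⟩ ⟨⌈M⌉, by
      have := Int.le_ceil M
      exact ⟨by linarith, hbig _ (le_abs.2 (Or.inl (by linarith)))⟩⟩
  have hi1' : (i : ℝ) < z.im := lt_of_le_of_ne hi1 fun h => hi2 (by
    have e : (⟨k, i⟩ : ℂ) = z := Complex.ext hk.symm h
    rw [e]; exact hz)
  have hj1' : z.im < (j : ℝ) := lt_of_le_of_ne hj1 fun h => hj2 (by
    have e : (⟨k, j⟩ : ℂ) = z := Complex.ext hk.symm h.symm
    rw [e]; exact hz)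
  have hmid : ∀ n : ℤ, i < n → n < j → (⟨k, n⟩ : ℂ) ∈ GW V := by
    intro n h1 h2
    by_contra h
    rcases le_total (n : ℝ) z.im with h3 | h3
    · have := hi3 n ⟨h3, h⟩; omega
    · have := hj3 n ⟨h3, h⟩; omega
  refine ⟨i, j, ⟨?_, hi2, hj2, ?_⟩, hi1', hj1'⟩
  · have : (i : ℝ) < j := hi1'.trans hj1'
    exact_mod_cast this
  intro y hy1 hy2
  have y1 := Int.floor_le y
  have y2 := Int.lt_floor_add_one y
  have z1 := Int.floor_le z.im
  have z2 := Int.lt_floor_add_one z.im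
  by_cases hyi : (⌊y⌋ : ℝ) = y
  · rw [← hyi] at hy1 hy2 ⊢
    exact hmid _ (by exact_mod_cast hy1) (by exact_mod_cast hy2)
  have y1' := lt_of_le_of_ne y1 hyi
  have key : ∀ n : ℤ, ((n : ℝ) ≤ y ∧ y ≤ n + 1) → n = ⌊y⌋ := by
    intro n hn
    have a1 : (n : ℝ) < ⌊y⌋ + 1 := by linarith
    have a2 : (⌊y⌋ : ℝ) < n + 1 := by linarith
    have b1 : n < ⌊y⌋ + 1 := by exact_mod_cast a1
    have b2 : ⌊y⌋ < n + 1 := by exact_mod_cast a2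
    omega
  rcases lt_trichotomy ⌊y⌋ ⌊z.im⌋ with h | h | h
  · have c1 : ((⌊y⌋ + 1 : ℤ) : ℝ) ≤ ⌊z.im⌋ := by exact_mod_cast h
    refine GW_mono (hmid (⌊y⌋ + 1) ?_ ?_) ?_
    · have : (i : ℝ) < ((⌊y⌋ + 1 : ℤ) : ℝ) := by push_cast; linarith
      exact_mod_cast this
    · have : ((⌊y⌋ + 1 : ℤ) : ℝ) < j := by linarith
      exact_mod_cast this
    · rintro m n ⟨e1, e2⟩
      refine ⟨e1, ?_⟩
      rw [key n e2]
      push_cast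
      constructor <;> linarith
  · refine GW_mono hz ?_
    rintro m n ⟨e1, e2⟩
    refine ⟨by rw [hk]; exact e1, ?_⟩
    rw [key n e2, h]
    exact ⟨z1, z2.le⟩
  · have c1 : ((⌊z.im⌋ + 1 : ℤ) : ℝ) ≤ ⌊y⌋ := by exact_mod_cast h
    push_cast at c1
    refine GW_mono (hmid ⌊y⌋ ?_ ?_) ?_
    · have : (i : ℝ) < (⌊y⌋ : ℝ) := by linarith
      exact_mod_cast this
    · have : (⌊y⌋ : ℝ) < j := by linarith
      exact_mod_cast this
    · rintro m n ⟨e1, e2⟩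
      refine ⟨e1, ?_⟩
      rw [key n e2]
      constructor <;> simp

theorem IG.bound {V : Set ℂ} {M : ℝ} (hM : ∀ z ∈ V, |z.re| < M ∧ |z.im| < M) {k i j : ℤ}
    (h : IG (GW V) k i j) : (k ∈ Icc (-⌈M⌉ - 1) (⌈M⌉ + 1)) ∧ (i ∈ Icc (-⌈M⌉ - 1) (⌈M⌉ + 1))
      ∧ (j ∈ Icc (-⌈M⌉ - 1) (⌈M⌉ + 1)) := by
  obtain ⟨h1, h2, h3, h4⟩ := h
  have hij : ((i + 1 : ℤ) : ℝ) ≤ j := by exact_mod_cast h1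
  push_cast at hij
  have a := hM _ (GW_sub V (h4 (i + 1 / 2) (by linarith) (by linarith)))
  have b := hM _ (GW_sub V (h4 (j - 1 / 2) (by linarith) (by linarith)))
  simp only [abs_lt] at a b
  have c := Int.le_ceil M
  obtain ⟨⟨a1, a2⟩, a3, a4⟩ := a
  obtain ⟨_, a5, a6⟩ := b
  have lo : ∀ n : ℤ, -M - 1 ≤ n → -⌈M⌉ - 1 ≤ n := by
    intro n hn
    have : ((-⌈M⌉ - 1 : ℤ) : ℝ) ≤ n := by push_cast; linarith
    exact_mod_cast this
  have up : ∀ n : ℤ, (n : ℝ) ≤ M + 1 → n ≤ ⌈M⌉ + 1 := by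
    intro n hn
    have : (n : ℝ) ≤ ((⌈M⌉ + 1 : ℤ) : ℝ) := by push_cast; linarith
    exact_mod_cast this
  refine ⟨⟨lo _ ?_, up _ ?_⟩, ⟨lo _ ?_, up _ ?_⟩, lo _ ?_, up _ ?_⟩ <;> linarith

theorem IG.disj {W : Set ℂ} {k i j k' i' j' : ℤ} (h : IG W k i j) (h' : IG W k' i' j')
    {z : ℂ} (hz : z ∈ box (k, i, j)) (hz' : z ∈ gate (k', i', j')) :
    k = k' ∧ i = i' ∧ j = j' := by
  obtain ⟨h1, h2, h3, h4⟩ := h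
  obtain ⟨h1', h2', h3', h4'⟩ := h'
  obtain ⟨⟨a, b⟩, c, d⟩ := hz
  obtain ⟨e, f, g⟩ := hz'
  dsimp only at a b c d e f g
  rw [e] at a b
  have hk : k = k' := by
    have a' : (k : ℝ) < k' + 1 := by linarith
    have a'' : k < k' + 1 := by exact_mod_cast a'
    have b'' : k' < k + 1 := by exact_mod_cast b
    omega
  subst hk
  refine ⟨rfl, ?_, ?_⟩
  · rcases lt_trichotomy i i' with u | u | u
    · exact absurd (h4 i' (by exact_mod_cast u) (by linarith)) h2'
    · exact u
    · exact absurd (h4' i (by exact_mod_cast u) (by linarith)) h2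
  · rcases lt_trichotomy j j' with u | u | u
    · exact absurd (h4' j (by linarith) (by exact_mod_cast u)) h3
    · exact u
    · exact absurd (h4 j' (by linarith) (by exact_mod_cast u)) h3'

theorem convex_comp {V W' : Set ℂ} (hW' : W' = {z | z ∈ GW V ∧ ∀ k : ℤ, z.re ≠ k}) :
    ∀ z ∈ W', Convex ℝ (connectedComponentIn W' z) := by
  intro z hz
  set C := connectedComponentIn W' z with hC
  have hCW : C ⊆ W' := connectedComponentIn_subset _ _
  have hzC : z ∈ C := mem_connectedComponentIn hz
  have hCp : IsPreconnected C := isPreconnected_connectedComponentIn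
  have hnz : ∀ c ∈ C, ∀ k : ℤ, c.re ≠ k := fun c hc => by
    have := hCW hc; rw [hW'] at this; exact this.2
  have hre : (re '' C).OrdConnected :=
    (hCp.image _ continuous_re.continuousOn).ordConnected
  have him : (im '' C).OrdConnected :=
    (hCp.image _ continuous_im.continuousOn).ordConnected
  set k := ⌊z.re⌋ with hk
  have k1 := Int.floor_le z.re
  have k2 := Int.lt_floor_add_one z.re
  have strip : ∀ c ∈ C, c.re ∈ Ioo (k : ℝ) (k + 1) := by
    intro c hc
    constructor
    · by_contra h
      push Not at h
      obtain ⟨d, hd, hd'⟩ := hre.out ⟨c, hc, rfl⟩ ⟨z, hzC, rfl⟩ ⟨h, k1⟩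
      exact hnz d hd k hd'
    · by_contra h
      push Not at h
      obtain ⟨d, hd, hd'⟩ := hre.out ⟨z, hzC, rfl⟩ ⟨c, hc, rfl⟩ ⟨k2.le, h⟩
      exact hnz d hd (k + 1) (by push_cast; exact hd')
  rw [convex_iff_segment_subset]
  intro a ha b hb w hw
  have hwre : w.re ∈ Ioo (k : ℝ) (k + 1) :=
    ((convex_Ioo (k : ℝ) (k + 1)).linear_preimage reLm).segment_subset (strip a ha) (strip b hb) hw
  have hwim : w.im ∈ im '' C :=
    (him.convex.linear_preimage imLm).segment_subset (x := a) (y := b) ⟨a, ha, rfl⟩ ⟨b, hb, rfl⟩ hw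
  obtain ⟨c, hc, hcw⟩ := hwim
  have hsub : segment ℝ c w ⊆ W' := by
    intro v hv
    have v1 : v.re ∈ Ioo (k : ℝ) (k + 1) :=
      ((convex_Ioo (k : ℝ) (k + 1)).linear_preimage reLm).segment_subset (strip c hc) hwre hv
    have v2 : v.im ∈ ({w.im} : Set ℝ) :=
      ((convex_singleton (𝕜 := ℝ) w.im).linear_preimage imLm).segment_subset (x := c) (y := w) hcw rfl hv
    have fl : ∀ m : ℤ, ∀ x : ℝ, x ∈ Ioo (k : ℝ) (k + 1) → (m : ℝ) ≤ x → x ≤ m + 1 → m = k := by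
      intro m x hx h1 h2
      have a1 : (m : ℝ) < k + 1 := by linarith [hx.2]
      have a2 : (k : ℝ) < m + 1 := by linarith [hx.1]
      have b1 : m < k + 1 := by exact_mod_cast a1
      have b2 : k < m + 1 := by exact_mod_cast a2
      omega
    have hc' := hCW hc
    rw [hW'] at hc' ⊢
    refine ⟨GW_mono hc'.1 ?_, ?_⟩
    · rintro m n ⟨e1, e2⟩
      have := fl m _ v1 e1.1 e1.2
      subst this
      refine ⟨⟨(strip c hc).1.le, (strip c hc).2.le⟩, ?_⟩
      rw [hcw, ← v2]; exact e2
    · intro m hm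
      rw [hm] at v1
      have b1 : k < m := by exact_mod_cast v1.1
      have b2 : m < k + 1 := by exact_mod_cast v1.2
      omega
  have := (convex_segment c w).isPreconnected.subset_connectedComponentIn (left_mem_segment ℝ c w) hsub
  rw [hC, connectedComponentIn_eq hc]
  exact this (right_mem_segment ℝ c w)

theorem scc_GW_of {V : Set ℂ} (hV : HF V) {M : ℝ} (hM : ∀ z ∈ V, |z.re| < M ∧ |z.im| < M) :
    SCC (GW V) := by
  classical
  set S : Set (ℝ × ℝ × ℝ) := {g | ∃ k i j : ℤ, IG (GW V) k i j ∧ g = ((k : ℝ), (i : ℝ), (j : ℝ))} with hS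
  have hfin : S.Finite := by
    have : ((Icc (-⌈M⌉ - 1) (⌈M⌉ + 1)) ×ˢ (Icc (-⌈M⌉ - 1) (⌈M⌉ + 1)) ×ˢ (Icc (-⌈M⌉ - 1) (⌈M⌉ + 1)) : Set (ℤ × ℤ × ℤ)).Finite :=
      (finite_Icc _ _).prod ((finite_Icc _ _).prod (finite_Icc _ _))
    refine (this.image (fun t => ((t.1 : ℝ), (t.2.1 : ℝ), (t.2.2 : ℝ)))).subset ?_
    rintro g ⟨k, i, j, h, rfl⟩
    exact ⟨(k, i, j), h.bound hM, rfl⟩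
  refine gates hfin.toFinset _ (isOpen_GW V) hV.GW ?_ ?_ ?_
  · intro g hg
    obtain ⟨k, i, j, h, rfl⟩ := hfin.mem_toFinset.1 hg
    exact h.isGate
  · intro g hg g' hg' hne
    obtain ⟨k, i, j, h, rfl⟩ := hfin.mem_toFinset.1 hg
    obtain ⟨k', i', j', h', rfl⟩ := hfin.mem_toFinset.1 hg'
    rw [Set.disjoint_left]
    intro z hz hz'
    obtain ⟨rfl, rfl, rfl⟩ := h.disj h' hz hz'
    exact hne rfl
  · refine SCC.of_convex_comp (convex_comp (V := V) ?_)
    ext z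
    constructor
    · rintro ⟨h1, h2⟩
      refine ⟨h1, fun k hk => h2 ?_⟩
      obtain ⟨i, j, h, h3, h4⟩ := IG.cover hM h1 hk
      exact mem_biUnion (x := ((k : ℝ), (i : ℝ), (j : ℝ))) (hfin.mem_toFinset.2 ⟨k, i, j, h, rfl⟩) ⟨hk, h3, h4⟩
    · rintro ⟨h1, h2⟩
      refine ⟨h1, fun h => ?_⟩
      obtain ⟨g, hg, hzg⟩ := mem_iUnion₂.1 h
      obtain ⟨k, i, j, h, rfl⟩ := hfin.mem_toFinset.1 hg
      exact h2 k hzg.1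


theorem HF.of_unbounded {W : Set ℂ}
    (h : ∀ a ∉ W, ∃ A : Set ℂ, a ∈ A ∧ IsPreconnected A ∧ ¬ IsBounded A ∧ Disjoint A W) : HF W := by
  intro G hG hb hfr a ha
  by_contra haW
  obtain ⟨A, haA, hA, hAb, hd⟩ := h a haW
  refine hAb (hb.subset ?_)
  refine hA.subset_of_closure_inter_subset hG ⟨a, haA, ha⟩ ?_
  rintro w ⟨hw, hwA⟩
  by_contra hwG
  exact Set.disjoint_left.1 hd hwA (hfr (by rw [hG.frontier_eq]; exact ⟨hw, hwG⟩))

theorem HF.inter {V W : Set ℂ} (hV : HF V) (hW : HF W) : HF (V ∩ W) := fun G hG hb hfr =>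
  subset_inter (hV G hG hb (hfr.trans inter_subset_left)) (hW G hG hb (hfr.trans inter_subset_right))

theorem HF.ball {M : ℝ} (hM : 0 < M) : HF (ball (0 : ℂ) M) := by
  refine HF.of_unbounded fun a ha => ?_
  rw [mem_ball_zero_iff, not_lt] at ha
  have hapos : 0 < ‖a‖ := hM.trans_le ha
  refine ⟨(fun t : ℝ => t • a) '' Ici 1, ⟨1, mem_Ici.2 le_rfl, one_smul _ _⟩,
    isPreconnected_Ici.image _ (by fun_prop), ?_, ?_⟩
  · intro hb
    obtain ⟨C, hC⟩ := hb.exists_norm_le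
    have := hC _ ⟨max 1 ((C + 1) / ‖a‖), mem_Ici.2 (le_max_left _ _), rfl⟩
    rw [norm_smul, Real.norm_eq_abs, abs_of_pos (lt_max_of_lt_left one_pos)] at this
    have h2 := mul_le_mul_of_nonneg_right (le_max_right 1 ((C + 1) / ‖a‖)) hapos.le
    rw [div_mul_cancel₀ _ hapos.ne'] at h2
    linarith
  · rw [Set.disjoint_left]
    rintro _ ⟨t, ht, rfl⟩ h
    rw [mem_ball_zero_iff, norm_smul, Real.norm_eq_abs, abs_of_pos (zero_lt_one.trans_le ht)] at h
    have := mul_le_mul_of_nonneg_right (mem_Ici.1 ht) hapos.le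
    linarith

theorem HF.scale {V : Set ℂ} (hV : HF V) {r : ℝ} (hr : 0 < r) : HF {z | (r : ℂ)⁻¹ * z ∈ V} := by
  have hr0 : (r : ℂ) ≠ 0 := by exact_mod_cast hr.ne'
  intro G hG hb hfr z hz
  set e : ℂ ≃ₜ ℂ := Homeomorph.mulLeft₀ (r : ℂ) hr0 with he
  have hev : ∀ w, e w = r * w := fun w => rfl
  have hb' : IsBounded (e ⁻¹' G) := by
    obtain ⟨C, hC⟩ := hb.exists_norm_le
    rw [isBounded_iff_forall_norm_le]
    refine ⟨C / r, fun w hw => ?_⟩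
    have := hC _ hw
    rw [hev, norm_mul, norm_real, Real.norm_eq_abs, abs_of_pos hr] at this
    rw [le_div_iff₀ hr]; linarith
  have := hV (e ⁻¹' G) (hG.preimage e.continuous) hb' (by
    rw [← e.preimage_frontier]
    intro w hw
    have := hfr hw
    rw [mem_ofPred_eq, hev, inv_mul_cancel_left₀ hr0] at this
    exact this)
  apply this
  rw [mem_preimage, hev, mul_inv_cancel_left₀ hr0]
  exact hz

theorem HF.scc {V : Set ℂ} (hVo : IsOpen V) (hV : HF V) : SCC V := by
  intro x y p q
  set T : Set ℂ := (range fun t => (p t : ℂ)) ∪ (range fun t => (q t : ℂ)) with hT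
  have hTc : IsCompact T := (isCompact_range (by fun_prop)).union (isCompact_range (by fun_prop))
  have hTV : T ⊆ V := by
    rintro _ (⟨t, rfl⟩ | ⟨t, rfl⟩)
    · exact (p t).2
    · exact (q t).2
  obtain ⟨δ, hδ, hδV⟩ := hTc.exists_thickening_subset_open hVo hTV
  obtain ⟨B, hB⟩ := hTc.isBounded.exists_norm_le
  set r : ℝ := 3 / δ with hr
  have hr0 : 0 < r := by positivity
  have hrc : (r : ℂ) ≠ 0 := by exact_mod_cast hr0.ne'
  set M : ℝ := r * |B| + 3 with hMdef
  have hM0 : 0 < M := by positivity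
  set V' : Set ℂ := {z | (r : ℂ)⁻¹ * z ∈ V} ∩ Metric.ball 0 M with hV'
  have hHF : HF V' := (hV.scale hr0).inter (HF.ball hM0)
  have hscc : SCC (Ark.GW V') := scc_GW_of hHF (M := M) (fun z hz => by
    have := mem_ball_zero_iff.1 hz.2
    exact ⟨(abs_re_le_norm z).trans_lt this, (abs_im_le_norm z).trans_lt this⟩)
  have hTG : ∀ z ∈ T, (r : ℂ) * z ∈ Ark.GW V' := by
    intro z hz m n hzQ w hw
    have hd : ‖w - r * z‖ ≤ 2 := by
      refine (Complex.norm_le_abs_re_add_abs_im _).trans ?_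
      obtain ⟨⟨a1, a2⟩, a3, a4⟩ := hzQ
      obtain ⟨⟨b1, b2⟩, b3, b4⟩ := hw
      have c1 : |(w - r * z).re| ≤ 1 := by rw [sub_re, abs_le]; constructor <;> linarith
      have c2 : |(w - r * z).im| ≤ 1 := by rw [sub_im, abs_le]; constructor <;> linarith
      linarith
    constructor
    · apply hδV
      rw [mem_thickening_iff]
      refine ⟨z, hz, ?_⟩
      rw [dist_eq_norm]
      have e : (r : ℂ)⁻¹ * w - z = (r : ℂ)⁻¹ * (w - r * z) := by
        rw [mul_sub, inv_mul_cancel_left₀ hrc]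
      rw [e, norm_mul, norm_inv, norm_real, Real.norm_eq_abs, abs_of_pos hr0, hr, inv_div]
      calc δ / 3 * ‖w - r * z‖ ≤ δ / 3 * 2 := by gcongr
        _ < δ := by linarith
    · rw [mem_ball_zero_iff]
      have h1 : ‖(r : ℂ) * z‖ ≤ r * |B| := by
        rw [norm_mul, norm_real, Real.norm_eq_abs, abs_of_pos hr0]
        have := (hB z hz).trans (le_abs_self B)
        gcongr
      have h2 : ‖w‖ ≤ ‖w - r * z‖ + ‖(r : ℂ) * z‖ := by
        simpa using norm_add_le (w - r * z) (r * z)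
      linarith
  have mk : ∀ (p : Path x y) (hp : ∀ t, (p t : ℂ) ∈ T), ∃ hx : (r : ℂ) * x ∈ Ark.GW V', ∃ hy : (r : ℂ) * y ∈ Ark.GW V',
      ∃ p' : Path (⟨_, hx⟩ : Ark.GW V') ⟨_, hy⟩, ∀ t, (p' t : ℂ) = r * p t := by
    intro p hp
    refine ⟨hTG _ (by simpa using hp 0), hTG _ (by simpa using hp 1),
      { toFun := fun t => ⟨r * p t, hTG _ (hp t)⟩
        continuous_toFun := by fun_prop
        source' := by simp
        target' := by simp }, fun t => rfl⟩
  obtain ⟨hx, hy, p', hp'⟩ := mk p (fun t => Or.inl ⟨t, rfl⟩)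
  obtain ⟨_, _, q', hq'⟩ := mk q (fun t => Or.inr ⟨t, rfl⟩)
  obtain ⟨F⟩ := hscc _ _ p' q'
  have hF : ∀ t, (r : ℂ)⁻¹ * (F t : ℂ) ∈ V := fun t => (GW_sub _ (F t).2).1
  refine ⟨{ toFun := fun t => ⟨(r : ℂ)⁻¹ * F t, hF t⟩
            continuous_toFun := by fun_prop
            map_zero_left := ?_
            map_one_left := ?_
            prop' := ?_ }⟩
  · intro t
    apply Subtype.ext
    have e : (F (0, t) : ℂ) = (p' t : ℂ) :=
      congrArg (fun z : (Ark.GW V' : Set ℂ) => (z : ℂ)) (F.map_zero_left t)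
    change (r : ℂ)⁻¹ * (F (0, t) : ℂ) = p t
    rw [e, hp', inv_mul_cancel_left₀ hrc]
  · intro t
    apply Subtype.ext
    have e : (F (1, t) : ℂ) = (q' t : ℂ) :=
      congrArg (fun z : (Ark.GW V' : Set ℂ) => (z : ℂ)) (F.map_one_left t)
    change (r : ℂ)⁻¹ * (F (1, t) : ℂ) = q t
    rw [e, hq', inv_mul_cancel_left₀ hrc]
  · intro t u hu
    apply Subtype.ext
    rcases hu with rfl | rfl <;> simp [hrc]

theorem SCC.sc {V : Set ℂ} (hVo : IsOpen V) (hV : SCC V) {z : ℂ} (hz : z ∈ V) :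
    SimplyConnectedSpace (connectedComponentIn V z) := by
  set C := connectedComponentIn V z with hC
  have hCo : IsOpen C := hVo.connectedComponentIn
  have hCp : IsPathConnected C :=
    (hCo.isConnected_iff_isPathConnected).1 (isConnected_connectedComponentIn_iff.2 hz)
  have hCV : C ⊆ V := connectedComponentIn_subset _ _
  have hYo : IsOpen (V \ C) := by
    rw [isOpen_iff_mem_nhds]
    rintro w ⟨hw, hwC⟩
    filter_upwards [hVo.connectedComponentIn.mem_nhds (mem_connectedComponentIn hw)] with v hv
    refine ⟨connectedComponentIn_subset _ _ hv, fun hvC => hwC ?_⟩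
    rw [hC, connectedComponentIn_eq hvC, ← connectedComponentIn_eq hv]
    exact mem_connectedComponentIn hw
  have hs : SCC C := SCC.sub hCo hYo disjoint_sdiff_right (by rw [union_sdiff_cancel hCV]; exact hV)
  rw [simply_connected_iff_paths_homotopic']
  exact ⟨isPathConnected_iff_pathConnectedSpace.1 hCp, fun {x y} p q => hs x y p q⟩

end Ark

namespace Ark
open Set Topology Filter unitInterval

theorem push_local {O : Set ℂ} (hO : IsOpen O) (R : ℝ) {z : ℂ} (hz : z ∈ O)
    (hu : ¬ IsBounded (connectedComponentIn O z)) :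
    ∃ (B : Set ℂ) (d : ℂ), B ∈ 𝓝 z ∧ IsCompact B ∧ IsPreconnected B ∧ B ⊆ O ∧ d ∈ B ∧ R ≤ ‖d‖ := by
  obtain ⟨d, hd, hdR⟩ : ∃ d ∈ connectedComponentIn O z, R ≤ ‖d‖ := by
    by_contra hcon
    push Not at hcon
    exact hu (isBounded_iff_forall_norm_le.2 ⟨R, fun w hw => (hcon w hw).le⟩)
  have hp : IsPathConnected (connectedComponentIn O z) :=
    (hO.connectedComponentIn.isConnected_iff_isPathConnected).1
      (isConnected_connectedComponentIn_iff.2 hz)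
  obtain ⟨γ, hγ⟩ := hp.joinedIn z (mem_connectedComponentIn hz) d hd
  obtain ⟨ε, hε, hεO⟩ := nhds_basis_closedBall.mem_iff.1 (hO.mem_nhds hz)
  refine ⟨closedBall z ε ∪ range γ, d, mem_of_superset (closedBall_mem_nhds z hε) subset_union_left,
    (isCompact_closedBall z ε).union (isCompact_range γ.continuous), ?_, ?_, ?_, hdR⟩
  · exact IsPreconnected.union z (mem_closedBall_self hε.le) ⟨0, by simp⟩
      (convex_closedBall z ε).isPreconnected (isPreconnected_range γ.continuous)
  · refine union_subset hεO ?_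
    rintro _ ⟨t, rfl⟩
    exact connectedComponentIn_subset _ _ (hγ t)
  · exact Or.inr ⟨1, by simp⟩

theorem push_step {O C : Set ℂ} (hO : IsOpen O) (R : ℝ) (hC : IsCompact C) (hCO : C ⊆ O)
    (hu : ∀ z ∈ C, ¬ IsBounded (connectedComponentIn O z)) :
    ∃ C' D : Set ℂ, C ⊆ C' ∧ IsCompact C' ∧ C' ⊆ O ∧ IsCompact D ∧ D ⊆ C' ∧ (∀ d ∈ D, R ≤ ‖d‖) ∧
      ∀ z ∈ C', ∃ A ⊆ C', z ∈ A ∧ IsPreconnected A ∧ ∃ d ∈ A, d ∈ D := by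
  have : ∀ z : ℂ, ∃ (B : Set ℂ) (d : ℂ), z ∈ C →
      (B ∈ 𝓝 z ∧ IsCompact B ∧ IsPreconnected B ∧ B ⊆ O ∧ d ∈ B ∧ R ≤ ‖d‖) := by
    intro z
    by_cases hz : z ∈ C
    · obtain ⟨B, d, h⟩ := push_local hO R (hCO hz) (hu z hz)
      exact ⟨B, d, fun _ => h⟩
    · exact ⟨∅, 0, fun h => absurd h hz⟩
  choose B d h using this
  obtain ⟨t, ht, hcov⟩ := hC.elim_nhds_subcover B (fun z hz => (h z hz).1)
  refine ⟨⋃ x ∈ t, B x, d '' t, hcov, t.isCompact_biUnion fun x hx => (h x (ht x hx)).2.1, ?_,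
    (t.finite_toSet.image d).isCompact, ?_, ?_, ?_⟩
  · exact iUnion₂_subset fun x hx => (h x (ht x hx)).2.2.2.1
  · rintro _ ⟨x, hx, rfl⟩
    exact mem_biUnion hx (h x (ht x hx)).2.2.2.2.1
  · rintro _ ⟨x, hx, rfl⟩
    exact (h x (ht x hx)).2.2.2.2.2
  · intro z hz
    obtain ⟨x, hx, hzx⟩ := mem_iUnion₂.1 hz
    have hh := h x (ht x hx)
    exact ⟨B x, subset_biUnion_of_mem (u := B) hx, hzx, hh.2.2.1, d x, hh.2.2.2.2.1, x, hx, rfl⟩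

theorem fwd {F : Set ℂ} (hF : IsClosed F) (h1 : ∀ z ∈ Fᶜ, ¬ IsBounded (connectedComponentIn Fᶜ z))
    (h2 : ∀ K : Set ℂ, IsCompact K →
      IsBounded {z : ℂ | z ∈ (F ∪ K)ᶜ ∧ IsBounded (connectedComponentIn (F ∪ K)ᶜ z)})
    {U : Set ℂ} (hU : IsOpen U) (hFU : F ⊆ U) : ∃ V, IsOpen V ∧ F ⊆ V ∧ V ⊆ U ∧ HF V := by
  set K : ℕ → Set ℂ := fun n => closedBall 0 ((n : ℝ) - 1) with hK
  have hr : ∀ n : ℕ, ∃ r : ℝ, (n = 0 → r = 0) ∧ (n : ℝ) ≤ r ∧ ∀ z ∉ F, r ≤ ‖z‖ →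
      z ∈ (F ∪ K n)ᶜ ∧ ¬ IsBounded (connectedComponentIn (F ∪ K n)ᶜ z) := by
    intro n
    by_cases hn : n = 0
    · subst hn
      have : K 0 = ∅ := by simp [hK]
      refine ⟨0, fun _ => rfl, by simp, fun z hz _ => ?_⟩
      rw [this, union_empty]
      exact ⟨hz, h1 z hz⟩
    · obtain ⟨R, hR⟩ := (h2 (K n) (isCompact_closedBall _ _)).exists_norm_le
      refine ⟨max (R + 1) n, fun h => absurd h hn, le_max_right _ _, fun z hz hzr => ?_⟩
      have a1 := (le_max_left _ _).trans hzr
      have a2 := (le_max_right _ _).trans hzr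
      have hmem : z ∈ (F ∪ K n)ᶜ := by
        rintro (h | h)
        · exact hz h
        · rw [hK, mem_closedBall_zero_iff] at h; linarith
      refine ⟨hmem, fun hb => ?_⟩
      have := hR z ⟨hmem, hb⟩
      linarith
  choose r hr0 hrn hr using hr
  have hstep : ∀ (n : ℕ) (C : Set ℂ), ∃ C' D : Set ℂ, (IsCompact C ∧ ∀ z ∈ C, z ∉ F ∧ r n ≤ ‖z‖) →
      C ⊆ C' ∧ IsCompact C' ∧ C' ⊆ (F ∪ K n)ᶜ ∧ IsCompact D ∧ D ⊆ C' ∧ (∀ d ∈ D, r (n + 1) ≤ ‖d‖) ∧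
      ∀ z ∈ C', ∃ A ⊆ C', z ∈ A ∧ IsPreconnected A ∧ ∃ d ∈ A, d ∈ D := by
    intro n C
    by_cases hC : (IsCompact C ∧ ∀ z ∈ C, z ∉ F ∧ r n ≤ ‖z‖)
    · obtain ⟨C', D, h⟩ := push_step (O := (F ∪ K n)ᶜ) (hF.union isClosed_closedBall).isOpen_compl (r (n + 1)) hC.1
        (fun z hz => (hr n z (hC.2 z hz).1 (hC.2 z hz).2).1)
        (fun z hz => (hr n z (hC.2 z hz).1 (hC.2 z hz).2).2)
      exact ⟨C', D, fun _ => h⟩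
    · exact ⟨∅, ∅, fun h => absurd h hC⟩
  choose C' D hCD using hstep
  set E : ℕ → Set ℂ := fun n => Uᶜ ∩ {z | r n ≤ ‖z‖ ∧ ‖z‖ ≤ r (n + 1)} with hE
  have hEc : ∀ n, IsCompact (E n) := by
    intro n
    refine (isCompact_closedBall (0 : ℂ) (r (n + 1))).of_isClosed_subset ?_ ?_
    · exact hU.isClosed_compl.inter ((isClosed_le continuous_const continuous_norm).inter
        (isClosed_le continuous_norm continuous_const))
    · intro z hz
      rw [mem_closedBall_zero_iff]
      exact hz.2.2
  let c : ℕ → Set ℂ := fun n => Nat.rec (E 0) (fun n c => D n c ∪ E (n + 1)) n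
  have c0 : c 0 = E 0 := rfl
  have cs : ∀ n, c (n + 1) = D n (c n) ∪ E (n + 1) := fun n => rfl
  have hEF : ∀ n, ∀ z ∈ E n, z ∉ F ∧ r n ≤ ‖z‖ := fun n z hz => ⟨fun h => hz.1 (hFU h), hz.2.1⟩
  have hP : ∀ n, IsCompact (c n) ∧ ∀ z ∈ c n, z ∉ F ∧ r n ≤ ‖z‖ := by
    intro n
    induction n with
    | zero => exact ⟨hEc 0, hEF 0⟩
    | succ n ih =>
      obtain ⟨e1, e2, e3, e4, e5, e6, e7⟩ := hCD n (c n) ih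
      rw [cs]
      refine ⟨e4.union (hEc _), ?_⟩
      rintro z (hz | hz)
      · exact ⟨fun h => e3 (e5 hz) (Or.inl h), e6 z hz⟩
      · exact hEF _ z hz
  have hQ := fun n => hCD n (c n) (hP n)
  set Γ : Set ℂ := ⋃ n, C' n (c n) with hΓ
  have hΓc : IsClosed Γ := by
    refine LocallyFinite.isClosed_iUnion ?_ fun n => (hQ n).2.1.isClosed
    intro z
    refine ⟨ball z 1, ball_mem_nhds z one_pos, ?_⟩
    refine (Set.finite_Iic ⌈‖z‖ + 2⌉₊).subset ?_
    rintro n ⟨w, hw, hwz⟩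
    have a1 : w ∉ K n := fun h => (hQ n).2.2.1 hw (Or.inr h)
    rw [hK, mem_closedBall_zero_iff, not_le] at a1
    rw [mem_ball, dist_eq_norm] at hwz
    have a2 : ‖w‖ ≤ ‖w - z‖ + ‖z‖ := by simpa using norm_add_le (w - z) z
    have a3 := Nat.le_ceil (‖z‖ + 2)
    have : (n : ℝ) ≤ (⌈‖z‖ + 2⌉₊ : ℝ) := by linarith
    exact mem_Iic.2 (by exact_mod_cast this)
  have hcΓ : ∀ n, C' n (c n) ⊆ Γ := fun n => subset_iUnion (fun n => C' n (c n)) n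
  have hUΓ : Uᶜ ⊆ Γ := by
    intro z hz
    have hex : ∃ n : ℕ, ‖z‖ ≤ r (n + 1) := by
      obtain ⟨n, hn⟩ := exists_nat_ge ‖z‖
      refine ⟨n, hn.trans ?_⟩
      have := hrn (n + 1)
      push_cast at this
      linarith
    classical
    have hm1 := Nat.find_spec hex
    set m := Nat.find hex with hm
    have hzE : z ∈ E m := by
      refine ⟨hz, ?_, hm1⟩
      rcases hk : m with _ | k
      · rw [hr0 0 rfl]; exact norm_nonneg z
      · have := Nat.find_min hex (m := k) (by rw [← hm, hk]; exact Nat.lt_succ_self k)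
        exact (not_le.1 this).le
    refine hcΓ m ((hQ m).1 ?_)
    rcases m with _ | k
    · exact hzE
    · rw [cs]; exact Or.inr hzE
  refine ⟨Γᶜ, hΓc.isOpen_compl, ?_, compl_subset_comm.1 hUΓ, ?_⟩
  · intro z hz hzΓ
    obtain ⟨n, hn⟩ := mem_iUnion.1 hzΓ
    exact (hQ n).2.2.1 hn (Or.inl hz)
  have hfar : ∀ k n : ℕ, ∀ z ∈ C' n (c n), ∃ A ⊆ Γ, z ∈ A ∧ IsPreconnected A ∧ ∃ d ∈ A, d ∈ c (n + k + 1) := by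
    intro k n z hz
    induction k with
    | zero =>
      obtain ⟨A, h1, h2, h3, d, h4, h5⟩ := (hQ n).2.2.2.2.2.2 z hz
      exact ⟨A, h1.trans (hcΓ n), h2, h3, d, h4, by rw [add_zero, cs]; exact Or.inl h5⟩
    | succ k ih =>
      obtain ⟨A, h1, h2, h3, d, h4, h5⟩ := ih
      obtain ⟨A', h1', h2', h3', d', h4', h5'⟩ := (hQ (n + k + 1)).2.2.2.2.2.2 d ((hQ _).1 h5)
      refine ⟨A ∪ A', union_subset h1 (h1'.trans (hcΓ _)), Or.inl h2, h3.union d h4 h2' h3', d',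
        Or.inr h4', ?_⟩
      rw [← add_assoc, cs]; exact Or.inl h5'
  refine HF.of_unbounded fun a ha => ?_
  rw [notMem_compl_iff] at ha
  refine ⟨connectedComponentIn Γ a, mem_connectedComponentIn ha, isPreconnected_connectedComponentIn, ?_,
    disjoint_compl_right_iff_subset.2 (connectedComponentIn_subset _ _)⟩
  intro hb
  obtain ⟨R, hR⟩ := hb.exists_norm_le
  obtain ⟨n, hn⟩ := mem_iUnion.1 ha
  obtain ⟨k, hk⟩ := exists_nat_ge R
  obtain ⟨A, g1, g2, g3, d, g4, g5⟩ := hfar k n a hn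
  have b1 := hR d (g3.subset_connectedComponentIn g2 g1 g4)
  have b2 := (hP (n + k + 1)).2 d g5
  have b3 := hrn (n + k + 1)
  push_cast at b3
  have : (0 : ℝ) ≤ n := Nat.cast_nonneg n
  linarith [b2.2]

end Ark

namespace Ark
open Set Topology Filter unitInterval

theorem log_on {V : Set ℂ} (hVo : IsOpen V) (hV : ∀ z ∈ V, SimplyConnectedSpace (connectedComponentIn V z))
    {a : ℂ} (ha : a ∉ V) : HasLog V a := by
  have : ∀ C : Set ℂ, ∃ f : ℂ → ℂ, (∃ z ∈ V, C = connectedComponentIn V z) →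
      ContinuousOn f C ∧ ∀ w ∈ C, exp (f w) = w - a := by
    intro C
    by_cases hC : ∃ z ∈ V, C = connectedComponentIn V z
    · obtain ⟨z, hz, rfl⟩ := hC
      obtain ⟨f, hf1, hf2⟩ := Complex.exists_continuousOn_eqOn_exp_comp (U := connectedComponentIn V z)
        (hV z hz) hVo.connectedComponentIn (g := fun w => w - a) (by fun_prop) (by
          rintro ⟨w, hw, hw0⟩
          rw [sub_eq_zero.1 hw0] at hw
          exact ha (connectedComponentIn_subset _ _ hw))
      exact ⟨f, fun _ => ⟨hf1, fun w hw => hf2 hw⟩⟩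
    · exact ⟨0, fun h => absurd h hC⟩
  choose f hf using this
  refine ⟨fun w => f (connectedComponentIn V w) w, ?_, ?_⟩
  · intro w hw
    apply ContinuousAt.continuousWithinAt
    have hn := hVo.connectedComponentIn.mem_nhds (mem_connectedComponentIn hw)
    have hc := (hf _ ⟨w, hw, rfl⟩).1.continuousAt hn
    refine hc.congr ?_
    filter_upwards [hn] with v hv
    rw [← connectedComponentIn_eq hv]
  · intro w hw
    exact (hf _ ⟨w, hw, rfl⟩).2 w (mem_connectedComponentIn hw)

theorem no_log {G : Set ℂ} (hb : IsBounded G) {a : ℂ} (ha : a ∈ G)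
    (hl : HasLog (frontier G) a) : False := by
  obtain ⟨g, hg1, hg2⟩ := hl
  obtain ⟨g', hg'⟩ := ContinuousMap.exists_restrict_eq (isClosed_frontier (s := G))
    ⟨(frontier G).domRestrict g, continuousOn_iff_continuous_domRestrict.1 hg1⟩
  have hgg : ∀ w ∈ frontier G, g' w = g w := fun w hw => by
    have := DFunLike.congr_fun hg' ⟨w, hw⟩
    exact this
  classical
  set h : ℂ → ℂ := G.piecewise (fun w => exp (g' w)) (fun w => w - a) with hh
  have hc : Continuous h := by
    refine Continuous.piecewise ?_ (by fun_prop) (by fun_prop)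
    intro w hw
    rw [hgg w hw, hg2 w hw]
  have h0 : ∀ w, h w ≠ 0 := by
    intro w
    by_cases hw : w ∈ G
    · rw [hh, piecewise_eq_of_mem _ _ _ hw]; exact exp_ne_zero _
    · rw [hh, piecewise_eq_of_notMem _ _ _ hw]
      intro h
      rw [sub_eq_zero.1 h] at hw
      exact hw ha
  have hsc : IsSimplyConnected (univ : Set ℂ) := by
    have := (convex_univ (𝕜 := ℝ) (E := ℂ)).contractibleSpace univ_nonempty
    exact SimplyConnectedSpace.ofContractible _
  obtain ⟨L, hL1, hL2⟩ := Complex.exists_continuousOn_eqOn_exp_comp hsc isOpen_univ (g := h)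
    hc.continuousOn (by rintro ⟨w, -, hw⟩; exact h0 w hw)
  rw [continuousOn_univ] at hL1
  obtain ⟨B, hB⟩ := hb.exists_norm_le
  set R : ℝ := |B| + ‖a‖ + 1 with hR
  have hRpos : 0 < R := by positivity
  have hout : ∀ t : ℝ, a + R * exp (t * Complex.I) ∉ G := by
    intro t ht
    have h1 := hB _ ht
    have h2 : ‖(R : ℂ) * exp (t * Complex.I)‖ = R := by
      rw [norm_mul, norm_exp_ofReal_mul_I, mul_one, norm_real, Real.norm_eq_abs, abs_of_pos hRpos]
    have h3 := norm_sub_le (a + R * exp (t * Complex.I)) a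
    rw [add_sub_cancel_left, h2] at h3
    have := le_abs_self B
    linarith
  have key := const_of_exp_one (X := ℝ) (S := univ) isPreconnected_univ
    (f := fun t : ℝ => L (a + R * exp (t * Complex.I)) - t * Complex.I - Real.log R)
    (by apply Continuous.continuousOn; fun_prop) (by
      intro t _
      have h4 := hL2 (mem_univ (a + R * exp (t * Complex.I)))
      rw [hh, piecewise_eq_of_notMem _ _ _ (hout t)] at h4
      simp only [Function.comp_apply, add_sub_cancel_left] at h4
      rw [exp_sub, exp_sub, h4, ← ofReal_exp, Real.exp_log hRpos]
      have : (R : ℂ) ≠ 0 := by exact_mod_cast hRpos.ne'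
      field_simp [exp_ne_zero]) (mem_univ 0) (mem_univ (2 * Real.pi))
  have e2 : exp (((2 * Real.pi : ℝ) : ℂ) * Complex.I) = 1 := by
    push_cast; exact exp_two_pi_mul_I
  simp only [e2, ofReal_zero, zero_mul, exp_zero, sub_zero] at key
  have := congrArg Complex.im key
  simp at this
  linarith [Real.pi_pos]

theorem HF_of_sc {V : Set ℂ} (hVo : IsOpen V)
    (hV : ∀ z ∈ V, SimplyConnectedSpace (connectedComponentIn V z)) : HF V := by
  intro G hG hb hfr a ha
  by_contra haV
  obtain ⟨g, h1, h2⟩ := log_on hVo hV haV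
  exact no_log hb ha ⟨g, h1.mono hfr, fun w hw => h2 w (hfr hw)⟩

theorem bwd1 {F : Set ℂ} (hF : IsClosed F)
    (h : ∀ U : Set ℂ, IsOpen U → F ⊆ U → ∃ V : Set ℂ, IsOpen V ∧ F ⊆ V ∧ V ⊆ U ∧ HF V) :
    ∀ z ∈ Fᶜ, ¬ IsBounded (connectedComponentIn Fᶜ z) := by
  intro z hz hb
  obtain ⟨V, hVo, hFV, hVU, hV⟩ := h {z}ᶜ isOpen_compl_singleton (by
    intro w hw h; rw [mem_singleton_iff.1 h] at hw; exact hz hw)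
  have hfr := frontier_comp hF.isOpen_compl z
  rw [compl_compl] at hfr
  exact hVU (hV _ hF.isOpen_compl.connectedComponentIn hb (hfr.trans hFV) (mem_connectedComponentIn hz)) rfl

theorem bwd2 {F : Set ℂ} (hF : IsClosed F)
    (h : ∀ U : Set ℂ, IsOpen U → F ⊆ U → ∃ V : Set ℂ, IsOpen V ∧ F ⊆ V ∧ V ⊆ U ∧ HF V)
    {K : Set ℂ} (hK : IsCompact K) :
    IsBounded {z : ℂ | z ∈ (F ∪ K)ᶜ ∧ IsBounded (connectedComponentIn (F ∪ K)ᶜ z)} := by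
  by_contra hcon
  set O := (F ∪ K)ᶜ with hO
  have hOo : IsOpen O := (hF.union hK.isClosed).isOpen_compl
  have hz : ∀ n : ℕ, ∃ z : ℂ, (z ∈ O ∧ IsBounded (connectedComponentIn O z)) ∧ (n : ℝ) < ‖z‖ := by
    intro n
    by_contra hn
    push Not at hn
    exact hcon (isBounded_iff_forall_norm_le.2 ⟨n, fun z hz => hn z hz⟩)
  choose z hz hzn using hz
  have hZ : IsClosed (⋃ n, {z n}) := by
    refine LocallyFinite.isClosed_iUnion ?_ fun n => isClosed_singleton
    intro x
    refine ⟨ball x 1, ball_mem_nhds x one_pos, ?_⟩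
    refine (Set.finite_Iic ⌈‖x‖ + 2⌉₊).subset ?_
    rintro n ⟨w, hw, hwz⟩
    rw [mem_singleton_iff.1 hw, mem_ball, dist_eq_norm] at hwz
    have a1 := hzn n
    have a2 : ‖z n‖ ≤ ‖z n - x‖ + ‖x‖ := by simpa using norm_add_le (z n - x) x
    have a3 := Nat.le_ceil (‖x‖ + 2)
    have : (n : ℝ) ≤ (⌈‖x‖ + 2⌉₊ : ℝ) := by linarith
    exact mem_Iic.2 (by exact_mod_cast this)
  obtain ⟨V, hVo, hFV, hVU, hV⟩ := h _ hZ.isOpen_compl (by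
    intro w hw hw'
    obtain ⟨n, hn⟩ := mem_iUnion.1 hw'
    rw [mem_singleton_iff.1 hn] at hw
    exact (hz n).1 (Or.inl hw))
  have hzV : ∀ n, z n ∉ V := fun n hn => hVU hn (mem_iUnion.2 ⟨n, rfl⟩)
  obtain ⟨R, hR⟩ := hK.isBounded.exists_norm_le
  have hw : ∀ n : ℕ, R + 1 < ‖z n‖ → ∃ w ∈ connectedComponentIn O (z n), ‖w‖ = R + 1 ∧ w ∉ V := by
    intro n hn
    by_contra hno
    push Not at hno
    refine hzV n (hV (connectedComponentIn O (z n) ∩ {w | R + 1 < ‖w‖})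
      (hOo.connectedComponentIn.inter (isOpen_lt continuous_const continuous_norm))
      ((hz n).2.subset inter_subset_left) ?_ ⟨mem_connectedComponentIn (hz n).1, hn⟩)
    intro w hw
    rw [(hOo.connectedComponentIn.inter (isOpen_lt continuous_const continuous_norm)).frontier_eq] at hw
    have hw1 : w ∈ closure (connectedComponentIn O (z n)) := closure_mono inter_subset_left hw.1
    have hw2 : R + 1 ≤ ‖w‖ :=
      closure_minimal (fun v hv => le_of_lt hv.2) (isClosed_le continuous_const continuous_norm) hw.1
    by_cases hwC : w ∈ connectedComponentIn O (z n)
    · refine hno w hwC (le_antisymm ?_ hw2)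
      by_contra hlt
      exact hw.2 ⟨hwC, not_le.1 hlt⟩
    · have hfr := frontier_comp hOo (z n) (by
        rw [hOo.connectedComponentIn.frontier_eq]; exact ⟨hw1, hwC⟩ : w ∈ frontier _)
      rw [hO, compl_compl] at hfr
      rcases hfr with hfr | hfr
      · exact hFV hfr
      · have := hR w hfr; linarith
  obtain ⟨N, hN⟩ := exists_nat_ge (R + 1)
  have hw' : ∀ n : ℕ, ∃ w ∈ connectedComponentIn O (z (n + N)), ‖w‖ = R + 1 ∧ w ∉ V := by
    intro n
    apply hw
    have := hzn (n + N)
    push_cast at this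
    have : (0 : ℝ) ≤ n := Nat.cast_nonneg n
    linarith
  choose w hw1 hw2 hw3 using hw'
  obtain ⟨x, hx, φ, hφ, hlim⟩ := (isCompact_sphere (0 : ℂ) (R + 1)).tendsto_subseq (x := w)
    (fun n => mem_sphere_zero_iff_norm.2 (hw2 n))
  have hxV : x ∈ Vᶜ := hVo.isClosed_compl.mem_of_tendsto hlim (Eventually.of_forall fun n => hw3 (φ n))
  have hxO : x ∈ O := by
    rintro (h | h)
    · exact hxV (hFV h)
    · have := hR x h
      rw [mem_sphere_zero_iff_norm] at hx
      linarith
  have hev := hlim.eventually (hOo.connectedComponentIn.mem_nhds (mem_connectedComponentIn hxO))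
  have heq : ∀ᶠ n in atTop, connectedComponentIn O x = connectedComponentIn O (z (φ n + N)) := by
    filter_upwards [hev] with n hn
    rw [connectedComponentIn_eq hn, connectedComponentIn_eq (hw1 (φ n))]
    rfl
  obtain ⟨n0, hn0⟩ := eventually_atTop.1 heq
  have hbx : IsBounded (connectedComponentIn O x) := by rw [hn0 n0 le_rfl]; exact (hz _).2
  obtain ⟨B, hB⟩ := hbx.exists_norm_le
  obtain ⟨n1, hn1⟩ := exists_nat_ge B
  have c1 := hB (z (φ (max n0 n1) + N)) (by
    rw [hn0 _ (le_max_left n0 n1)]; exact mem_connectedComponentIn (hz _).1)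
  have c2 := hzn (φ (max n0 n1) + N)
  have c3 : n1 ≤ φ (max n0 n1) + N := (le_max_right n0 n1).trans ((hφ.id_le _).trans (Nat.le_add_right _ _))
  have c4 : (n1 : ℝ) ≤ ((φ (max n0 n1) + N : ℕ) : ℝ) := by exact_mod_cast c3
  linarith

end Ark

theorem arakelian_iff_simply_connected_basis (F : Set ℂ) (hF : IsClosed F) :
    IsArakelian F ↔
      ∀ U : Set ℂ, IsOpen U → F ⊆ U →
        ∃ V : Set ℂ, IsOpen V ∧ F ⊆ V ∧ V ⊆ U ∧
          ∀ z ∈ V, SimplyConnectedSpace (connectedComponentIn V z) := by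
  constructor
  · rintro ⟨h1, h2⟩ U hU hFU
    obtain ⟨V, hV, hFV, hVU, hHF⟩ := Ark.fwd hF h1 h2 hU hFU
    exact ⟨V, hV, hFV, hVU, fun z hz => (Ark.HF.scc hV hHF).sc hV hz⟩
  · intro h
    have h' : ∀ U : Set ℂ, IsOpen U → F ⊆ U →
        ∃ V : Set ℂ, IsOpen V ∧ F ⊆ V ∧ V ⊆ U ∧ Ark.HF V := by
      intro U hU hFU
      obtain ⟨V, hV, hFV, hVU, hs⟩ := h U hU hFU
      exact ⟨V, hV, hFV, hVU, Ark.HF_of_sc hV hs⟩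
    exact ⟨Ark.bwd1 hF h', fun K hK => Ark.bwd2 hF h' hK⟩
end

section
/- Let K ⊆ ℂ be a compact set, let U₀ ⊇ K be an open set, and let f : U₀ → ℂ be holomorphic on U₀ with no zeros on K. Assume there exists a continuous function g : K → ℂ such that exp(g(z)) = f(z) for all z ∈ K. Then there exist an open set V with K ⊆ V ⊆ U₀ and a holomorphic function G : V → ℂ such that G(z) = g(z) for all z ∈ K and exp(G(z)) = f(z) for all z ∈ V. -/
open Complex

/-- A continuous logarithm of a holomorphic function is holomorphic. -/
theorem differentiableOn_of_exp {V : Set ℂ} {f G : ℂ → ℂ} (hV : IsOpen V)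
    (hf : DifferentiableOn ℂ f V) (hG : ContinuousOn G V)
    (h : ∀ z ∈ V, Complex.exp (G z) = f z) : DifferentiableOn ℂ G V := by
  intro a ha
  have hVa := hV.mem_nhds ha
  have hfa : DifferentiableAt ℂ f a := (hf a ha).differentiableAt hVa
  have hGa : ContinuousAt G a := hG.continuousAt hVa
  have h0 : f a ≠ 0 := by rw [← h a ha]; exact Complex.exp_ne_zero _
  have hd : DifferentiableAt ℂ (fun z => G a + log (f z / f a)) a := by
    refine (DifferentiableAt.clog (hfa.div_const _) ?_).const_add _
    rw [div_self h0]
    exact one_mem_slitPlane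
  refine DifferentiableAt.differentiableWithinAt (hd.congr_of_eventuallyEq ?_)
  have hnear : ∀ᶠ z in nhds a, dist (G z) (G a) < Real.pi :=
    hGa.eventually (Metric.ball_mem_nhds _ Real.pi_pos)
  filter_upwards [hnear, hVa] with z hz hzV
  rw [dist_eq_norm] at hz
  have him := abs_lt.1 ((Complex.abs_im_le_norm (G z - G a)).trans_lt hz)
  rw [← h z hzV, ← h a ha, ← Complex.exp_sub, Complex.log_exp him.1 him.2.le]
  ring

theorem extend_log_of_compact (K U₀ : Set ℂ) (hK : IsCompact K) (hU₀ : IsOpen U₀)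
    (hKU : K ⊆ U₀) (f : ℂ → ℂ) (hf : DifferentiableOn ℂ f U₀)
    (hfz : ∀ z ∈ K, f z ≠ 0) (g : ℂ → ℂ) (hg : ContinuousOn g K)
    (hfg : ∀ z ∈ K, Complex.exp (g z) = f z) :
    ∃ V : Set ℂ, IsOpen V ∧ K ⊆ V ∧ V ⊆ U₀ ∧
      ∃ G : ℂ → ℂ, DifferentiableOn ℂ G V ∧ (∀ z ∈ K, G z = g z) ∧
        ∀ z ∈ V, Complex.exp (G z) = f z := by
  obtain ⟨e, he⟩ := ContinuousMap.exists_restrict_eq hK.isClosed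
    (⟨K.domRestrict g, hg.domRestrict⟩ : C(K, ℂ))
  have heK : ∀ z ∈ K, e z = g z := fun z hz => by
    have := DFunLike.congr_fun he ⟨z, hz⟩
    exact this
  have hec : Continuous e := e.continuous
  have hh : ContinuousOn (fun z => f z * exp (-e z)) U₀ :=
    hf.continuousOn.mul (by fun_prop)
  have h1 : ∀ z ∈ K, f z * exp (-e z) = 1 := fun z hz => by
    rw [heK z hz, ← hfg z hz, ← Complex.exp_add]; simp
  have hVo : IsOpen (U₀ ∩ (fun z => f z * exp (-e z)) ⁻¹' slitPlane) :=
    hh.isOpen_inter_preimage hU₀ isOpen_slitPlane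
  have hexp : ∀ z ∈ U₀ ∩ (fun z => f z * exp (-e z)) ⁻¹' slitPlane,
      exp (e z + log (f z * exp (-e z))) = f z := fun z hz => by
    rw [Complex.exp_add, Complex.exp_log (slitPlane_ne_zero hz.2), mul_left_comm,
      ← Complex.exp_add]
    simp
  have hGc : ContinuousOn (fun z => e z + log (f z * exp (-e z)))
      (U₀ ∩ (fun z => f z * exp (-e z)) ⁻¹' slitPlane) :=
    hec.continuousOn.add ((hh.mono Set.inter_subset_left).clog fun z hz => hz.2)
  refine ⟨_, hVo, fun z hz => ⟨hKU hz, ?_⟩, Set.inter_subset_left,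
    fun z => e z + log (f z * exp (-e z)), ?_, fun z hz => ?_, hexp⟩
  · simp only [Set.mem_preimage]
    rw [h1 z hz]
    exact one_mem_slitPlane
  · exact differentiableOn_of_exp hVo (hf.mono Set.inter_subset_left) hGc hexp
  · change e z + log (f z * exp (-e z)) = g z
    rw [h1 z hz, heK z hz, log_one, add_zero]
end

section
/- Let U ⊆ ℂ be a bounded domain (a nonempty bounded open connected set), let {Bᵢ}ᵢ∈I be the collection of bounded connected components of ℂ \ U, and let V = U ∪ (⋃ᵢ∈I Bᵢ) be the filling of U. Then V is an open, bounded, connected, and simply connected set, and the topological frontier of V is contained in the topological frontier of U. -/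
open Complex Metric Bornology

/-- The filling of a set `U ⊆ ℂ`: the union of `U` with all bounded connected
components of its complement. -/
def filling (U : Set ℂ) : Set ℂ :=
  U ∪ {z : ℂ | z ∈ Uᶜ ∧ IsBounded (connectedComponentIn Uᶜ z)}
open Set Topology

lemma mem_compl_filling {U : Set ℂ} {z : ℂ} :
    z ∈ (filling U)ᶜ ↔ z ∈ Uᶜ ∧ ¬ IsBounded (connectedComponentIn Uᶜ z) := by
  unfold filling
  simp only [mem_compl_iff, mem_union, mem_ofPred_eq, not_or, not_and]
  tauto

lemma component_subset_compl_filling {U : Set ℂ} {z : ℂ} (hz : z ∈ (filling U)ᶜ) :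
    connectedComponentIn Uᶜ z ⊆ (filling U)ᶜ := by
  intro y hy
  rw [mem_compl_filling] at hz ⊢
  refine ⟨connectedComponentIn_subset _ _ hy, ?_⟩
  rw [← connectedComponentIn_eq hy]
  exact hz.2

lemma component_subset_filling {U : Set ℂ} {z : ℂ} (hz : z ∈ filling U) :
    connectedComponentIn Uᶜ z ⊆ filling U := by
  intro y hy
  by_contra h
  have hzU : z ∈ Uᶜ := by
    rw [← connectedComponentIn_nonempty_iff]; exact ⟨y, hy⟩
  have := component_subset_compl_filling (z := y) h
  rw [← connectedComponentIn_eq hy] at this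
  exact this (mem_connectedComponentIn hzU) hz

lemma isPreconnected_outside {r : ℝ} (hr : 0 < r) : IsPreconnected {z : ℂ | r ≤ ‖z‖} := by
  have h : {z : ℂ | r ≤ ‖z‖} = Complex.exp '' {w : ℂ | Real.log r ≤ w.re} := by
    ext z
    constructor
    · intro hz
      have hz' : r ≤ ‖z‖ := hz
      have h0 : z ≠ 0 := by
        rw [← norm_pos_iff]; linarith
      refine ⟨Complex.log z, ?_, Complex.exp_log h0⟩
      simp only [mem_ofPred_eq, Complex.log_re]
      exact Real.log_le_log hr hz'
    · rintro ⟨w, hw, rfl⟩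
      simp only [mem_ofPred_eq, Complex.norm_exp] at hw ⊢
      exact (Real.log_le_iff_le_exp hr).1 hw
  rw [h]
  exact ((convex_halfSpace_re_ge _).isPreconnected).image _ Complex.continuous_exp.continuousOn

lemma outside_not_bounded (r : ℝ) : ¬ IsBounded {z : ℂ | r ≤ ‖z‖} := by
  intro h
  obtain ⟨C, hC⟩ := h.exists_norm_le
  have := hC ((|C| + |r| + 1 : ℝ) : ℂ) (by
    simp only [mem_ofPred_eq, Complex.norm_real, Real.norm_eq_abs]
    rw [abs_of_nonneg (by positivity)]
    have := le_abs_self r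
    have := abs_nonneg C
    linarith)
  rw [Complex.norm_real, Real.norm_eq_abs, abs_of_nonneg (by positivity)] at this
  have h1 := le_abs_self C
  have h2 := abs_nonneg r
  linarith

lemma filling_basic (U : Set ℂ) (hUo : IsOpen U) (hUc : IsConnected U) (hUb : IsBounded U) :
    IsOpen (filling U) ∧ IsBounded (filling U) ∧ IsConnected (filling U) ∧
      frontier (filling U) ⊆ frontier U := by
  obtain ⟨R, hR0, hR⟩ : ∃ R : ℝ, 0 < R ∧ ∀ x ∈ U, ‖x‖ < R := by
    obtain ⟨R, hR0, hR⟩ := hUb.exists_pos_norm_lt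
    exact ⟨R, hR0, hR⟩
  have hout : {z : ℂ | R ≤ ‖z‖} ⊆ Uᶜ := fun z hz hzU => by
    have := hR z hzU
    have hz' : R ≤ ‖z‖ := hz
    linarith
  have hRm : (R : ℂ) ∈ {z : ℂ | R ≤ ‖z‖} := by
    simp [le_abs_self]
  have hcompl : (filling U)ᶜ = connectedComponentIn Uᶜ (R : ℂ) := by
    have hsub := (isPreconnected_outside hR0).subset_connectedComponentIn hRm hout
    apply Subset.antisymm
    · intro z hz
      have hz' := mem_compl_filling.1 hz
      have : ∃ y ∈ connectedComponentIn Uᶜ z, R ≤ ‖y‖ := by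
        by_contra! hcon
        apply hz'.2
        rw [isBounded_iff_forall_norm_le]
        exact ⟨R, fun x hx => (hcon x hx).le⟩
      obtain ⟨y, hy, hyR⟩ := this
      have h1 := connectedComponentIn_eq hy
      have h2 := connectedComponentIn_eq (hsub hyR)
      rw [h2, ← h1]
      exact mem_connectedComponentIn hz'.1
    · apply component_subset_compl_filling
      rw [mem_compl_filling]
      exact ⟨hout hRm, fun hb => outside_not_bounded R (hb.subset hsub)⟩
  have hVo : IsOpen (filling U) := by
    rw [← isClosed_compl_iff, hcompl, ← closure_subset_iff_isClosed]
    have hpre : IsPreconnected (connectedComponentIn Uᶜ (R : ℂ)) :=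
      isPreconnected_connectedComponentIn
    apply hpre.closure.subset_connectedComponentIn
    · exact subset_closure (mem_connectedComponentIn (hout hRm))
    · exact closure_minimal (connectedComponentIn_subset _ _) hUo.isClosed_compl
  have hVb : IsBounded (filling U) := by
    rw [isBounded_iff_forall_norm_le]
    refine ⟨R, fun x hx => ?_⟩
    by_contra! hcon
    have hsub := (isPreconnected_outside hR0).subset_connectedComponentIn hRm hout
    have : x ∈ (filling U)ᶜ := by
      rw [hcompl]; exact hsub hcon.le
    exact this hx
  have hUV : U ⊆ filling U := subset_union_left
  refine ⟨hVo, hVb, ⟨hUc.nonempty.mono hUV, ?_⟩, ?_⟩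
  · -- connectedness
    rw [isPreconnected_iff_subset_of_disjoint]
    have key : ∀ u v : Set ℂ, IsOpen u → IsOpen v → filling U ⊆ u ∪ v →
        filling U ∩ (u ∩ v) = ∅ → U ⊆ u → filling U ⊆ u := by
      intro u v hu hv hsub hdis hUu z hz
      by_contra hzu
      have hzv : z ∈ v := (hsub hz).resolve_left hzu
      have hzU : z ∈ Uᶜ := fun h => hzu (hUu h)
      have hB := component_subset_filling hz
      have hzB := mem_connectedComponentIn hzU
      have hBv : connectedComponentIn Uᶜ z ⊆ v := by
        have hp : IsPreconnected (connectedComponentIn Uᶜ z) :=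
          isPreconnected_connectedComponentIn
        rw [isPreconnected_iff_subset_of_disjoint] at hp
        rcases hp u v hu hv (hB.trans hsub) (by
          apply subset_empty_iff.1
          rw [← hdis]
          exact inter_subset_inter_left _ hB) with h | h
        · exact absurd (h hzB) hzu
        · exact h
      have hopen : IsOpen (connectedComponentIn Uᶜ z) := by
        rw [isOpen_iff_mem_nhds]
        intro y hy
        rw [connectedComponentIn_eq hy]
        apply connectedComponentIn_mem_nhds
        filter_upwards [(hVo.inter hv).mem_nhds ⟨hB hy, hBv hy⟩] with x hx hxU
        have : x ∈ filling U ∩ (u ∩ v) := ⟨hx.1, hUu hxU, hx.2⟩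
        rw [hdis] at this
        exact this
      have hclosed : IsClosed (connectedComponentIn Uᶜ z) := by
        rw [← closure_subset_iff_isClosed]
        have hpre : IsPreconnected (connectedComponentIn Uᶜ z) :=
          isPreconnected_connectedComponentIn
        apply hpre.closure.subset_connectedComponentIn
        · exact subset_closure hzB
        · exact closure_minimal (connectedComponentIn_subset _ _) hUo.isClosed_compl
      have huniv := IsClopen.eq_univ ⟨hclosed, hopen⟩ ⟨z, hzB⟩
      obtain ⟨x, hx⟩ := hUc.nonempty
      have : x ∈ connectedComponentIn Uᶜ z := by rw [huniv]; trivial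
      exact connectedComponentIn_subset _ _ this hx
    intro u v hu hv hsub hdis
    have hUp := hUc.isPreconnected
    rw [isPreconnected_iff_subset_of_disjoint] at hUp
    rcases hUp u v hu hv (hUV.trans hsub) (by
          apply subset_empty_iff.1
          rw [← hdis]
          exact inter_subset_inter_left _ hUV) with h | h
    · exact Or.inl (key u v hu hv hsub hdis h)
    · exact Or.inr (key v u hv hu (by rwa [union_comm]) (by rwa [inter_comm v u]) h)
  · intro x hx
    rw [hVo.frontier_eq] at hx
    rw [hUo.frontier_eq]
    refine ⟨?_, fun h => hx.2 (hUV h)⟩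
    by_contra hcl
    have hn : Uᶜ ∈ 𝓝 x := by
      filter_upwards [isClosed_closure.isOpen_compl.mem_nhds hcl] with y hy hyU
      exact hy (subset_closure hyU)
    have h1 := connectedComponentIn_mem_nhds hn
    have h2 := component_subset_compl_filling (z := x) hx.2
    obtain ⟨y, hy1, hy2⟩ := mem_closure_iff_nhds.1 hx.1 _ h1
    exact h2 hy1 hy2


/-! ### Logarithms of `z - p` -/

lemma exists_log_sub {L C : Set ℂ} (hL : IsCompact L) (hC : IsPreconnected C)
    (hCb : ¬ IsBounded C) (hCL : Disjoint C L) {p : ℂ} (hp : p ∈ C) :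
    ∃ g : ℂ → ℂ, ContinuousOn g L ∧ ∀ z ∈ L, Complex.exp (g z) = z - p := by
  -- the set of good points
  let T : Set ℂ := {q | q ∉ L ∧ ∃ g : ℂ → ℂ, ContinuousOn g L ∧ ∀ z ∈ L, Complex.exp (g z) = z - q}
  have step : ∀ q q' : ℂ, q ∉ L → (∀ z ∈ L, ‖q' - q‖ < ‖z - q‖) → (q ∈ T ↔ q' ∈ T) := by
    intro q q' hq hd
    have hsl : ∀ z ∈ L, (1 - (q' - q) / (z - q)) ∈ Complex.slitPlane := by
      intro z hz
      rw [sub_eq_add_neg]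
      apply Complex.mem_slitPlane_of_norm_lt_one
      rw [norm_neg, norm_div, div_lt_one]
      · exact hd z hz
      · exact (norm_nonneg _).trans_lt (hd z hz)
    have hne : ∀ z ∈ L, z - q ≠ 0 := fun z hz => sub_ne_zero.2 (fun h => hq (h ▸ hz))
    have hq' : q' ∉ L := fun h => lt_irrefl _ (hd q' h)
    have hcont : ContinuousOn (fun z => Complex.log (1 - (q' - q) / (z - q))) L := by
      apply ContinuousOn.clog _ hsl
      apply continuousOn_const.sub
      apply continuousOn_const.div (by fun_prop) hne
    have hexp : ∀ z ∈ L, Complex.exp (Complex.log (1 - (q' - q) / (z - q))) =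
        (z - q') / (z - q) := by
      intro z hz
      rw [Complex.exp_log (Complex.slitPlane_ne_zero (hsl z hz))]
      have := hne z hz
      field_simp
      ring
    constructor
    · rintro ⟨_, g, hg, hg'⟩
      refine ⟨hq', _, hg.add hcont, fun z hz => ?_⟩
      have := hne z hz
      show Complex.exp (g z + Complex.log (1 - (q' - q) / (z - q))) = z - q'
      rw [Complex.exp_add, hg' z hz, hexp z hz]
      field_simp
    · rintro ⟨_, g, hg, hg'⟩
      refine ⟨hq, _, hg.sub hcont, fun z hz => ?_⟩
      have := hne z hz
      have : z - q' ≠ 0 := sub_ne_zero.2 (fun h => hq' (h ▸ hz))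
      show Complex.exp (g z - Complex.log (1 - (q' - q) / (z - q))) = z - q
      rw [Complex.exp_sub, hg' z hz, hexp z hz]
      field_simp
  have near : ∀ q, q ∉ L → ∃ ε > 0, ∀ q' ∈ ball q ε, ∀ z ∈ L, ‖q' - q‖ < ‖z - q‖ := by
    intro q hq
    obtain ⟨ε, hε, hb⟩ := Metric.isOpen_iff.1 hL.isClosed.isOpen_compl q hq
    refine ⟨ε, hε, fun q' hq' z hz => ?_⟩
    rw [mem_ball, dist_eq_norm] at hq'
    by_contra! h
    have : z ∈ ball q ε := by
      rw [mem_ball, dist_eq_norm]; linarith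
    exact hb this hz
  have hTo : IsOpen T := by
    rw [Metric.isOpen_iff]
    intro q hq
    obtain ⟨ε, hε, h⟩ := near q hq.1
    exact ⟨ε, hε, fun q' hq' => (step q q' hq.1 (h q' hq')).1 hq⟩
  have hTo' : IsOpen (Lᶜ \ T) := by
    rw [Metric.isOpen_iff]
    intro q hq
    obtain ⟨ε, hε, h⟩ := near q hq.1
    refine ⟨ε, hε, fun q' hq' => ⟨fun h' => lt_irrefl _ (h q' hq' q' h'), fun h' => hq.2 ?_⟩⟩
    exact (step q q' hq.1 (h q' hq')).2 h'
  obtain ⟨R, hR0, hR⟩ := hL.isBounded.exists_pos_norm_lt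
  have hfar : ∀ q : ℂ, R ≤ ‖q‖ → q ∈ T := by
    intro q hq
    have hq0 : q ≠ 0 := by rw [← norm_pos_iff]; linarith
    have hsl : ∀ z ∈ L, (1 - z / q) ∈ Complex.slitPlane := by
      intro z hz
      rw [sub_eq_add_neg]
      apply Complex.mem_slitPlane_of_norm_lt_one
      rw [norm_neg, norm_div, div_lt_one]
      · exact (hR z hz).trans_le hq
      · linarith
    refine ⟨fun h => by linarith [hR q h], fun z => Complex.log (1 - z / q) + Complex.log (-q),
      ?_, ?_⟩
    · exact (ContinuousOn.clog (by fun_prop) hsl).add continuousOn_const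
    · intro z hz
      rw [Complex.exp_add, Complex.exp_log (Complex.slitPlane_ne_zero (hsl z hz)),
        Complex.exp_log (neg_ne_zero.2 hq0)]
      field_simp
      ring
  have hCsub : C ⊆ T ∪ (Lᶜ \ T) := by
    intro x hx
    by_cases h : x ∈ T
    · exact Or.inl h
    · exact Or.inr ⟨Set.disjoint_left.1 hCL hx, h⟩
  have hCT : C ⊆ T := by
    apply hC.subset_left_of_subset_union hTo hTo' disjoint_sdiff_self_right hCsub
    by_contra hcon
    apply hCb
    rw [isBounded_iff_forall_norm_le]
    refine ⟨R, fun x hx => ?_⟩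
    by_contra! h
    exact hcon ⟨x, hx, hfar x h.le⟩
  exact (hCT hp).2

lemma log_unique {S : Set ℂ} (hS : IsPreconnected S) {F : ℂ → ℂ} (hF : ContinuousOn F S)
    {c : ℂ} (hc : ∀ z ∈ S, Complex.exp (F z) = c) {x y : ℂ} (hx : x ∈ S) (hy : y ∈ S) :
    F x = F y := by
  have hint : ∀ z ∈ S, ∃ k : ℤ, F z = F y + k * (2 * Real.pi * Complex.I) := fun z hz =>
    Complex.exp_eq_exp_iff_exists_int.1 ((hc z hz).trans (hc y hy).symm)
  have hpi : (2 * Real.pi : ℝ) ≠ 0 := by positivity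
  have hd : DiscreteTopology (range (fun k : ℤ => (k : ℝ))) :=
    Int.isClosedEmbedding_coe_real.isEmbedding.toHomeomorph.symm.isEmbedding.discreteTopology
  have hcont : ContinuousOn (fun z => ((F z).im - (F y).im) / (2 * Real.pi)) S := by
    apply ContinuousOn.div_const
    exact (Complex.continuous_im.comp_continuousOn hF).sub continuousOn_const
  have := hS.constant_of_mapsTo (T := range (fun k : ℤ => (k : ℝ))) ⟨hd⟩ hcont (by
    intro z hz
    obtain ⟨k, hk⟩ := hint z hz
    refine ⟨k, ?_⟩
    simp only [hk]
    simp) hx hy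
  obtain ⟨k, hk⟩ := hint x hx
  simp only [sub_self, zero_div, div_eq_zero_iff, hpi, or_false] at this
  have h2 : (F x).im = (F y).im + k * (2 * Real.pi) := by rw [hk]; simp
  have : (k : ℝ) = 0 := by
    have h3 : (k : ℝ) * (2 * Real.pi) = 0 := by linarith
    exact (mul_eq_zero.1 h3).resolve_right hpi
  have hk0 : k = 0 := by exact_mod_cast this
  rw [hk, hk0]; simp

lemma slit_aux {w d : ℂ} (hd : d ≠ 0) (h : ∀ r : ℝ, 0 ≤ r → w ≠ -(r : ℂ) * d) :
    w / d ∈ Complex.slitPlane := by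
  by_contra hcon
  rw [Complex.mem_slitPlane_iff] at hcon
  push Not at hcon
  apply h (-(w / d).re) (by linarith [hcon.1])
  have : w / d = ((w / d).re : ℂ) := by
    apply Complex.ext <;> simp [hcon.2]
  have h2 : w = (w / d) * d := by field_simp
  rw [this] at h2
  rw [Complex.ofReal_neg, neg_neg]
  exact h2


/-! ### Lattice loops -/

/-- The lattice point of `ℂ` attached to a pair of integers. -/
def lat (v : ℤ × ℤ) : ℂ := ⟨(v.1 : ℝ), (v.2 : ℝ)⟩

/-- Two lattice points are equal or adjacent. -/
def LStep (u v : ℤ × ℤ) : Prop := |u.1 - v.1| + |u.2 - v.2| ≤ 1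

/-- The closed unit square with top left corner `(a, b)`. -/
def lsq (a b : ℤ) : Set ℂ :=
  {z | (a : ℝ) ≤ z.re ∧ z.re ≤ a + 1 ∧ (b : ℝ) - 1 ≤ z.im ∧ z.im ≤ b}

lemma mem_seg_re {u v : ℤ × ℤ} {z : ℂ} (hz : z ∈ segment ℝ (lat u) (lat v)) :
    ∃ s t : ℝ, 0 ≤ s ∧ 0 ≤ t ∧ s + t = 1 ∧ z.re = s * u.1 + t * v.1 ∧ z.im = s * u.2 + t * v.2 := by
  obtain ⟨s, t, hs, ht, hst, rfl⟩ := hz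
  exact ⟨s, t, hs, ht, hst, by simp [lat], by simp [lat]⟩

lemma lstep_cases {u v : ℤ × ℤ} (h : LStep u v) :
    u = v ∨ (v.1 = u.1 + 1 ∧ v.2 = u.2) ∨ (v.1 = u.1 - 1 ∧ v.2 = u.2) ∨
      (v.1 = u.1 ∧ v.2 = u.2 + 1) ∨ (v.1 = u.1 ∧ v.2 = u.2 - 1) := by
  unfold LStep at h
  rcases u with ⟨u1, u2⟩
  rcases v with ⟨v1, v2⟩
  simp only [Prod.mk.injEq] at *
  rcases abs_cases (u1 - v1) with h1 | h1 <;> rcases abs_cases (u2 - v2) with h2 | h2 <;> omega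

/-- An edge either has constant integer first or second coordinate. -/
lemma seg_int {u v : ℤ × ℤ} (h : LStep u v) {z : ℂ} (hz : z ∈ segment ℝ (lat u) (lat v)) :
    (∃ k : ℤ, z.re = k) ∨ (∃ k : ℤ, z.im = k) := by
  obtain ⟨s, t, hs, ht, hst, h1, h2⟩ := mem_seg_re hz
  have : u.1 = v.1 ∨ u.2 = v.2 := by
    rcases lstep_cases h with h | h | h | h | h
    · left; rw [h]
    all_goals omega
  rcases this with h | h
  · left
    refine ⟨u.1, ?_⟩
    rw [h1, ← h, ← add_mul, hst, one_mul]
  · right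
    refine ⟨u.2, ?_⟩
    rw [h2, ← h, ← add_mul, hst, one_mul]

/-- A lattice point on an edge is an endpoint. -/
lemma seg_lat {u v c : ℤ × ℤ} (h : LStep u v) (hz : lat c ∈ segment ℝ (lat u) (lat v)) :
    c = u ∨ c = v := by
  obtain ⟨s, t, hs, ht, hst, h1, h2⟩ := mem_seg_re hz
  simp only [lat] at h1 h2
  have hs' : s = 1 - t := by linarith
  subst hs'
  have key : ∀ x y z : ℤ, (y = x + 1 ∨ y = x - 1) → (z : ℝ) = (1 - t) * x + t * y →
      z = x ∨ z = y := by
    intro x y z hxy hz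
    rcases hxy with h | h
    · subst h
      push_cast at hz
      have e1 : (x : ℝ) ≤ z := by nlinarith
      have e2 : (z : ℝ) ≤ x + 1 := by nlinarith
      have e1' : x ≤ z := by exact_mod_cast e1
      have e2' : z ≤ x + 1 := by exact_mod_cast e2
      omega
    · subst h
      push_cast at hz
      have e1 : (x : ℝ) - 1 ≤ z := by nlinarith
      have e2 : (z : ℝ) ≤ x := by nlinarith
      have e1' : x - 1 ≤ z := by exact_mod_cast e1
      have e2' : z ≤ x := by exact_mod_cast e2
      omega
  have key2 : ∀ x y z : ℤ, y = x → (z : ℝ) = (1 - t) * x + t * y → z = x := by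
    intro x y z hxy hz
    subst hxy
    have : (z : ℝ) = y := by rw [hz]; ring
    exact_mod_cast this
  rcases lstep_cases h with h | ⟨h, h'⟩ | ⟨h, h'⟩ | ⟨h, h'⟩ | ⟨h, h'⟩
  · subst h
    left
    exact Prod.ext (key2 _ _ _ rfl h1) (key2 _ _ _ rfl h2)
  · have q2 := key2 _ _ _ h' h2
    rcases key _ _ _ (Or.inl h) h1 with q | q
    · exact Or.inl (Prod.ext q q2)
    · exact Or.inr (Prod.ext q (q2.trans h'.symm))
  · have q2 := key2 _ _ _ h' h2
    rcases key _ _ _ (Or.inr h) h1 with q | q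
    · exact Or.inl (Prod.ext q q2)
    · exact Or.inr (Prod.ext q (q2.trans h'.symm))
  · have q2 := key2 _ _ _ h h1
    rcases key _ _ _ (Or.inl h') h2 with q | q
    · exact Or.inl (Prod.ext q2 q)
    · exact Or.inr (Prod.ext (q2.trans h.symm) q)
  · have q2 := key2 _ _ _ h h1
    rcases key _ _ _ (Or.inr h') h2 with q | q
    · exact Or.inl (Prod.ext q2 q)
    · exact Or.inr (Prod.ext (q2.trans h.symm) q)

/-- The logarithm of `z - p` exists on compact subsets of `V`, for `p ∉ V`. -/
def HasLogs (V : Set ℂ) : Prop :=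
  ∀ p, p ∉ V → ∀ L : Set ℂ, IsCompact L → L ⊆ V →
    ∃ g : ℂ → ℂ, ContinuousOn g L ∧ ∀ z ∈ L, Complex.exp (g z) = z - p

lemma isCompact_seg (x y : ℂ) : IsCompact (segment ℝ x y) := by
  rw [segment_eq_image]
  exact isCompact_Icc.image (by fun_prop)

/-- The square below a top left corner of a simple lattice loop in `V` is contained in `V`. -/
lemma square_subset {V : Set ℂ} (hV : HasLogs V) {n : ℕ} (hn : 3 ≤ n) {w : ℕ → ℤ × ℤ}
    (hstep : ∀ i, LStep (w i) (w (i + 1)))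
    (hseg : ∀ i, segment ℝ (lat (w i)) (lat (w (i + 1))) ⊆ V)
    {a b : ℤ} (h0 : w 0 = (a, b)) (hwn : w n = (a, b))
    (hne : ∀ i, 1 ≤ i → i < n → w i ≠ (a, b)) (hb : ∀ i, (w i).2 ≤ b)
    (hcor : (w 1 = (a + 1, b) ∧ w (n - 1) = (a, b - 1)) ∨
      (w 1 = (a, b - 1) ∧ w (n - 1) = (a + 1, b))) :
    lsq a b ⊆ V := by
  intro p hp
  by_contra hpV
  set L : Set ℂ := ⋃ i ∈ Finset.range n, segment ℝ (lat (w i)) (lat (w (i + 1))) with hLdef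
  have hLc : IsCompact L := (Finset.range n).isCompact_biUnion fun i _ => isCompact_seg _ _
  have hLV : L ⊆ V := by
    intro z hz
    simp only [hLdef, mem_iUnion] at hz
    obtain ⟨i, _, hz⟩ := hz
    exact hseg i hz
  have hsegL : ∀ i, i < n → segment ℝ (lat (w i)) (lat (w (i + 1))) ⊆ L := by
    intro i hi z hz
    simp only [hLdef, mem_iUnion]
    exact ⟨i, Finset.mem_range.2 hi, hz⟩
  obtain ⟨g, hgc, hg⟩ := hV p hpV L hLc hLV
  have hpL : p ∉ L := fun h => hpV (hLV h)
  set c : ℂ := lat (a, b) with hc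
  set e1 : ℂ := lat (a + 1, b) with he1
  set e2 : ℂ := lat (a, b - 1) with he2
  have hn1 : n - 1 + 1 = n := by omega
  have hE1 : segment ℝ c e1 ⊆ L := by
    rcases hcor with ⟨h1, h2⟩ | ⟨h1, h2⟩
    · have := hsegL 0 (by omega)
      rwa [h0, zero_add, h1] at this
    · have := hsegL (n - 1) (by omega)
      rw [hn1, hwn, h2] at this
      rwa [segment_symm]
  have hE2 : segment ℝ c e2 ⊆ L := by
    rcases hcor with ⟨h1, h2⟩ | ⟨h1, h2⟩
    · have := hsegL (n - 1) (by omega)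
      rw [hn1, hwn, h2] at this
      rwa [segment_symm]
    · have := hsegL 0 (by omega)
      rwa [h0, zero_add, h1] at this
  obtain ⟨hp1, hp2, hp3, hp4⟩ := hp
  have hα : (a : ℝ) < p.re := by
    rcases hp1.lt_or_eq with h | h
    · exact h
    · exfalso
      apply hpL
      apply hE2
      refine ⟨p.im - b + 1, b - p.im, by linarith, by linarith, by ring, ?_⟩
      apply Complex.ext
      · simp [hc, he2, lat, ← h]; ring
      · simp [hc, he2, lat]; ring
  have hβ : p.im < b := by
    rcases hp4.lt_or_eq with h | h
    · exact h
    · exfalso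
      apply hpL
      apply hE1
      refine ⟨1 - (p.re - a), p.re - a, by linarith, by linarith, by ring, ?_⟩
      apply Complex.ext
      · simp [hc, he1, lat]; ring
      · simp [hc, he1, lat, h]; ring
  set d : ℂ := c - p with hd
  have hdre : d.re = a - p.re := by simp [hd, hc, lat]
  have hdim : d.im = b - p.im := by simp [hd, hc, lat]
  have hd0 : d ≠ 0 := by
    intro h
    rw [h] at hdre
    simp at hdre
    linarith
  -- near branch
  have near : ∀ S : Set ℂ, IsPreconnected S → S ⊆ L → c ∈ S → ∀ e ∈ S,
      (∀ z ∈ S, (z - p) / d ∈ Complex.slitPlane) →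
      g e - Complex.log ((e - p) / d) = g c - Complex.log ((c - p) / d) := by
    intro S hS hSL hcS e he hsl
    refine log_unique hS (F := fun z => g z - Complex.log ((z - p) / d)) (c := d) ?_ ?_ he hcS
    · exact (hgc.mono hSL).sub (ContinuousOn.clog (by fun_prop) hsl)
    · intro z hz
      have h1 : z - p ≠ 0 := sub_ne_zero.2 fun h => hpL (h ▸ hSL hz)
      rw [Complex.exp_sub, hg z (hSL hz), Complex.exp_log (Complex.slitPlane_ne_zero (hsl z hz))]
      field_simp
  have n1 := near _ (convex_segment c e1).isPreconnected hE1 (left_mem_segment _ _ _) e1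
    (right_mem_segment _ _ _) (by
      intro z hz
      apply slit_aux hd0
      intro r hr h
      obtain ⟨s, t, hs, ht, hst, h1, h2⟩ := mem_seg_re hz
      have := congrArg Complex.im h
      simp [hdim] at this
      rw [h2] at this
      have e : s * (b : ℝ) + t * b = b := by rw [← add_mul, hst, one_mul]
      simp only at this
      rw [e] at this
      nlinarith)
  have n2 := near _ (convex_segment c e2).isPreconnected hE2 (left_mem_segment _ _ _) e2
    (right_mem_segment _ _ _) (by
      intro z hz
      apply slit_aux hd0
      intro r hr h
      obtain ⟨s, t, hs, ht, hst, h1, h2⟩ := mem_seg_re hz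
      have := congrArg Complex.re h
      simp [hdre] at this
      rw [h1] at this
      have e : s * (a : ℝ) + t * a = a := by rw [← add_mul, hst, one_mul]
      simp only at this
      rw [e] at this
      nlinarith)
  -- far branch
  have far : ∀ i, 1 ≤ i → i + 1 < n →
      g (lat (w (i + 1))) - Complex.log ((lat (w (i + 1)) - p) / (-d)) =
        g (lat (w i)) - Complex.log ((lat (w i) - p) / (-d)) := by
    intro i hi hin
    have hSL := hsegL i (by omega)
    have hsl : ∀ z ∈ segment ℝ (lat (w i)) (lat (w (i + 1))),
        (z - p) / (-d) ∈ Complex.slitPlane := by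
      intro z hz
      apply slit_aux (neg_ne_zero.2 hd0)
      intro r hr h
      have hre : z.re - p.re = r * (a - p.re) := by
        have := congrArg Complex.re h
        simpa [hdre] using this
      have him : z.im - p.im = r * (b - p.im) := by
        have := congrArg Complex.im h
        simpa [hdim] using this
      have hzb : z.im ≤ b := by
        obtain ⟨s, t, hs, ht, hst, h1, h2⟩ := mem_seg_re hz
        have b1 : ((w i).2 : ℝ) ≤ b := by exact_mod_cast hb i
        have b2 : ((w (i + 1)).2 : ℝ) ≤ b := by exact_mod_cast hb (i + 1)
        rw [h2]
        have : (b : ℝ) = s * b + t * b := by rw [← add_mul, hst, one_mul]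
        rw [this]
        gcongr
      have hr1 : r ≤ 1 := by
        by_contra! h1
        nlinarith
      rcases hr.eq_or_lt with h1 | h1
      · subst h1
        apply hpL
        have : z = p := by
          apply Complex.ext <;> linarith
        rw [← this]
        exact hSL hz
      rcases hr1.eq_or_lt with h2 | h2
      · subst h2
        have : z = lat (a, b) := by
          apply Complex.ext <;> simp [lat] <;> linarith
        rw [this] at hz
        rcases seg_lat (hstep i) hz with h | h
        · exact hne i hi (by omega) h.symm
        · exact hne (i + 1) (by omega) hin h.symm
      · have q1 : (a : ℝ) < z.re := by nlinarith
        have q2 : z.re < a + 1 := by nlinarith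
        have q3 : (b : ℝ) - 1 < z.im := by nlinarith
        have q4 : z.im < b := by nlinarith
        rcases seg_int (hstep i) hz with ⟨k, hk⟩ | ⟨k, hk⟩
        · rw [hk] at q1 q2
          have q1' : a < k := by exact_mod_cast q1
          have q2' : k < a + 1 := by exact_mod_cast q2
          omega
        · rw [hk] at q3 q4
          have q3' : b - 1 < k := by exact_mod_cast q3
          have q4' : k < b := by exact_mod_cast q4
          omega
    refine log_unique (convex_segment _ _).isPreconnected
      (F := fun z => g z - Complex.log ((z - p) / (-d))) (c := -d) ?_ ?_
      (right_mem_segment _ _ _) (left_mem_segment _ _ _)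
    · exact (hgc.mono hSL).sub (ContinuousOn.clog (by fun_prop) hsl)
    · intro z hz
      have h1 : z - p ≠ 0 := sub_ne_zero.2 fun h => hpL (h ▸ hSL hz)
      rw [Complex.exp_sub, hg z (hSL hz), Complex.exp_log (Complex.slitPlane_ne_zero (hsl z hz))]
      field_simp
  have far' : ∀ i, 1 ≤ i → i < n →
      g (lat (w i)) - Complex.log ((lat (w i) - p) / (-d)) =
        g (lat (w 1)) - Complex.log ((lat (w 1) - p) / (-d)) := by
    intro i hi
    induction i, hi using Nat.le_induction with
    | base => intro _; rfl
    | succ i hi ih => intro hin; rw [far i hi hin, ih (by omega)]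
  have f := far' (n - 1) (by omega) (by omega)
  have f' : g e1 - Complex.log ((e1 - p) / (-d)) = g e2 - Complex.log ((e2 - p) / (-d)) := by
    rcases hcor with ⟨h1, h2⟩ | ⟨h1, h2⟩
    · rw [h1, h2] at f
      exact f.symm
    · rw [h1, h2] at f
      exact f
  rw [div_neg, div_neg] at f'
  have hns : 0 < Complex.normSq d := Complex.normSq_pos.2 hd0
  have i1 : ((e1 - p) / d).im < 0 := by
    rw [Complex.div_im, hdre, hdim, ← sub_div]
    apply div_neg_of_neg_of_pos _ hns
    simp [he1, lat]
    nlinarith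
  have i2 : 0 < ((e2 - p) / d).im := by
    rw [Complex.div_im, hdre, hdim, ← sub_div]
    apply div_pos _ hns
    simp [he2, lat]
    nlinarith
  have a1 := Complex.arg_neg_eq_arg_add_pi_of_im_neg i1
  have a2 := Complex.arg_neg_eq_arg_sub_pi_of_im_pos i2
  have m1 := congrArg Complex.im f'
  have m2 := congrArg Complex.im n1
  have m3 := congrArg Complex.im n2
  simp only [Complex.sub_im, Complex.log_im, a1, a2] at m1 m2 m3
  have := Real.pi_pos
  linarith


/-! ### Holonomy of lattice loops -/

/-- The ordered product of a two-variable function along a walk. -/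
def hol {A G : Type*} [Group G] (φ : A → A → G) (w : ℕ → A) : ℕ → G
  | 0 => 1
  | n + 1 => hol φ w n * φ (w n) (w (n + 1))

lemma hol_add {A G : Type*} [Group G] (φ : A → A → G) (w : ℕ → A) (m n : ℕ) :
    hol φ w (m + n) = hol φ w m * hol φ (fun i => w (i + m)) n := by
  induction n with
  | zero => simp [hol]
  | succ n ih =>
    rw [← add_assoc, hol, ih, hol, mul_assoc]
    have e1 : n + m = m + n := add_comm _ _
    have e2 : n + 1 + m = m + n + 1 := by ring
    rw [e1, e2]

lemma hol_congr {A G : Type*} [Group G] (φ : A → A → G) {w w' : ℕ → A} {n : ℕ}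
    (h : ∀ i ≤ n, w i = w' i) : hol φ w n = hol φ w' n := by
  induction n with
  | zero => rfl
  | succ n ih =>
    rw [hol, hol, ih (fun i hi => h i (by omega)), h n (by omega), h (n + 1) le_rfl]

lemma hol_one {A G : Type*} [Group G] (φ : A → A → G) (w : ℕ → A) :
    hol φ w 1 = φ (w 0) (w 1) := by
  simp [hol]

/-- Periodic lattice walks in `V` with heights bounded below by `M`. -/
structure LLoop (V : Set ℂ) (M : ℤ) (n : ℕ) (w : ℕ → ℤ × ℤ) : Prop where
  per : ∀ i, w (i + n) = w i
  step : ∀ i, LStep (w i) (w (i + 1))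
  seg : ∀ i, segment ℝ (lat (w i)) (lat (w (i + 1))) ⊆ V
  low : ∀ i, M ≤ (w i).2

lemma LLoop.shift {V : Set ℂ} {M : ℤ} {n : ℕ} {w : ℕ → ℤ × ℤ} (h : LLoop V M n w) (k : ℕ) :
    LLoop V M n (fun i => w (i + k)) where
  per i := by
    have : i + n + k = i + k + n := by ring
    simp only [this, h.per]
  step i := by
    have : i + 1 + k = i + k + 1 := by ring
    simp only [this]
    exact h.step _
  seg i := by
    have : i + 1 + k = i + k + 1 := by ring
    simp only [this]
    exact h.seg _
  low i := h.low _

lemma hol_shift_one {A G : Type*} [Group G] (φ : A → A → G) {w : ℕ → A} {n : ℕ}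
    (h : ∀ i, w (i + n) = w i) (k : ℕ) (h1 : hol φ (fun i => w (i + k)) n = 1) :
    hol φ w n = 1 := by
  have e1 := hol_add φ w k n
  have e2 := hol_add φ w n k
  have e3 : (fun i => w (i + n)) = w := funext h
  rw [h1, mul_one] at e1
  rw [e3, add_comm n k, e1] at e2
  have := mul_eq_right.1 e2.symm
  exact this

lemma sum_shift {w : ℕ → ℤ × ℤ} {n : ℕ} (h : ∀ i, w (i + n) = w i) (M : ℤ) (k : ℕ) :
    ∑ i ∈ Finset.range n, ((w (i + k)).2 - M) = ∑ i ∈ Finset.range n, ((w i).2 - M) := by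
  have e1 := Finset.sum_range_add (fun i => (w i).2 - M) k n
  have e2 := Finset.sum_range_add (fun i => (w i).2 - M) n k
  have e3 : ∀ i, w (n + i) = w i := fun i => by rw [add_comm, h]
  simp only [e3] at e2
  rw [add_comm n k] at e2
  have e4 : ∀ i, w (k + i) = w (i + k) := fun i => by rw [add_comm]
  simp only [e4] at e1
  linarith

/-- A period piece of a walk, repeated. -/
lemma LLoop.piece {V : Set ℂ} {M : ℤ} {w : ℕ → ℤ × ℤ}
    (hstep : ∀ i, LStep (w i) (w (i + 1)))
    (hseg : ∀ i, segment ℝ (lat (w i)) (lat (w (i + 1))) ⊆ V)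
    (hlow : ∀ i, M ≤ (w i).2) {m : ℕ} (hm : 0 < m) (hc : w m = w 0) :
    LLoop V M m (fun i => w (i % m)) := by
  have key : ∀ i, w ((i + 1) % m) = w (i % m + 1) := by
    intro i
    have hlt := Nat.mod_lt i hm
    rcases Nat.lt_or_ge (i % m + 1) m with h | h
    · rw [Nat.add_mod, Nat.mod_eq_of_lt (show 1 < m by omega), Nat.mod_eq_of_lt h]
    · have h' : i % m + 1 = m := by omega
      have : (i + 1) % m = 0 := by
        rw [← Nat.mod_add_mod, h', Nat.mod_self]
      rw [this, h', hc]
  refine ⟨fun i => by simp, fun i => ?_, fun i => ?_, fun i => hlow _⟩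
  · simp only [key]; exact hstep _
  · simp only [key]; exact hseg _

lemma hol_piece {A G : Type*} [Group G] (φ : A → A → G) {w : ℕ → A} {m : ℕ} (hc : w m = w 0) :
    hol φ (fun i => w (i % m)) m = hol φ w m := by
  apply hol_congr
  intro i hi
  rcases hi.eq_or_lt with h | h
  · subst h; simp [hc]
  · rw [Nat.mod_eq_of_lt h]

lemma convex_lsq (a b : ℤ) : Convex ℝ (lsq a b) := by
  have : lsq a b = {z : ℂ | (a : ℝ) ≤ z.re} ∩ ({z : ℂ | z.re ≤ a + 1} ∩
      ({z : ℂ | (b : ℝ) - 1 ≤ z.im} ∩ {z : ℂ | z.im ≤ b})) := by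
    ext z; simp [lsq]
  rw [this]
  exact (convex_halfSpace_re_ge _).inter ((convex_halfSpace_re_le _).inter
    ((convex_halfSpace_im_ge _).inter (convex_halfSpace_im_le _)))

theorem hol_eq_one {V : Set ℂ} (hV : HasLogs V) {G : Type*} [Group G] (φ : ℤ × ℤ → ℤ × ℤ → G)
    (hφ : ∀ u v x, convexHull ℝ {lat u, lat v, lat x} ⊆ V → φ u v * φ v x = φ u x) (M : ℤ) :
    ∀ (n : ℕ) (s : ℕ) (w : ℕ → ℤ × ℤ), LLoop V M n w →
      ∑ i ∈ Finset.range n, ((w i).2 - M) = s → hol φ w n = 1 := by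
  intro n
  induction n using Nat.strong_induction_on with
  | _ n ihn =>
  intro s
  induction s using Nat.strong_induction_on with
  | _ s ihs =>
  intro w hw hs
  have hn' : ∀ m, m < n → ∀ w, LLoop V M m w → hol φ w m = 1 := by
    intro m hm w hw
    refine ihn m hm (∑ i ∈ Finset.range m, ((w i).2 - M)).toNat w hw ?_
    rw [Int.toNat_of_nonneg]
    exact Finset.sum_nonneg fun i _ => sub_nonneg.2 (hw.low i)
  have hrefl : ∀ i, φ (w i) (w i) = 1 := by
    intro i
    have := hφ (w i) (w i) (w i) (by
      simp only [convexHull_singleton, singleton_subset_iff,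
        mem_singleton_iff, insert_eq_of_mem]
      exact hw.seg i (left_mem_segment _ _ _))
    exact mul_eq_left.1 this
  rcases Nat.eq_zero_or_pos n with hn0 | hn0
  · subst hn0; rfl
  by_cases hsimple : ∃ i k, 0 < k ∧ k < n ∧ w (i + k) = w i
  · obtain ⟨i, k, hk0, hkn, hik⟩ := hsimple
    apply hol_shift_one φ hw.per i
    set u : ℕ → ℤ × ℤ := fun j => w (j + i) with hu
    have huL : LLoop V M n u := hw.shift i
    have hu0 : u k = u 0 := by
      simp only [hu, zero_add]
      rw [add_comm, hik]
    have e : n = k + (n - k) := by omega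
    have e2 := hol_add φ u k (n - k)
    rw [← e] at e2
    rw [e2]
    have c2 : u (n - k + k) = u (0 + k) := by
      have : n - k + k = 0 + n := by omega
      rw [this, huL.per, zero_add, hu0]
    have p1 := hn' k hkn _ (LLoop.piece huL.step huL.seg huL.low hk0 hu0)
    have hsh := huL.shift k
    have p2 := hn' (n - k) (by omega) _
      (LLoop.piece (w := fun j => u (j + k)) hsh.step hsh.seg hsh.low (by omega) c2)
    rw [hol_piece φ hu0] at p1
    rw [hol_piece (w := fun j => u (j + k)) φ c2] at p2
    rw [p1, p2, one_mul]
  push Not at hsimple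
  -- now the loop is simple
  rcases Nat.lt_or_ge n 3 with hn3 | hn3
  · have : n = 1 ∨ n = 2 := by omega
    rcases this with h | h
    · subst h
      rw [hol_one]
      have := hw.per 0
      rw [zero_add] at this
      rw [this, hrefl]
    · subst h
      have h20 : w 2 = w 0 := hw.per 0
      simp only [hol, one_mul, zero_add]
      have e : (1 + 1 : ℕ) = 2 := rfl
      rw [e, h20, hφ (w 0) (w 1) (w 0), hrefl]
      have : ({lat (w 0), lat (w 1), lat (w 0)} : Set ℂ) = {lat (w 0), lat (w 1)} := by
        ext; simp; tauto
      rw [this, convexHull_pair]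
      exact hw.seg 0
  -- top left vertex
  obtain ⟨i0, hi0, hmax⟩ := Finset.exists_max_image (Finset.range n)
    (fun i => toLex ((w i).2, -(w i).1)) ⟨0, Finset.mem_range.2 hn0⟩
  have hmod : ∀ j, w j = w (j % n) := by
    intro j
    have : Function.Periodic w n := hw.per
    exact (this.map_mod_nat j).symm
  have hmax' : ∀ j, (w j).2 < (w i0).2 ∨ ((w j).2 = (w i0).2 ∧ (w i0).1 ≤ (w j).1) := by
    intro j
    have := hmax (j % n) (Finset.mem_range.2 (Nat.mod_lt _ hn0))
    rw [← hmod, Prod.Lex.toLex_le_toLex] at this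
    simpa using this
  apply hol_shift_one φ hw.per i0
  set u : ℕ → ℤ × ℤ := fun j => w (j + i0) with hu
  have huL : LLoop V M n u := hw.shift i0
  have husum : ∑ i ∈ Finset.range n, ((u i).2 - M) = s := by
    rw [← hs, ← sum_shift hw.per M i0]
  obtain ⟨a, b, hab⟩ : ∃ a b, w i0 = (a, b) := ⟨_, _, rfl⟩
  have hu0 : u 0 = (a, b) := by simp [hu, hab]
  have hun : u n = (a, b) := by
    have := huL.per 0
    rw [zero_add] at this
    rw [this, hu0]
  have hmaxu : ∀ j, (u j).2 < b ∨ ((u j).2 = b ∧ a ≤ (u j).1) := by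
    intro j
    have := hmax' (j + i0)
    rwa [hab] at this
  have hsimu : ∀ i k, 0 < k → k < n → u (i + k) ≠ u i := by
    intro i k h1 h2 h3
    apply hsimple (i + i0) k h1 h2
    have : i + i0 + k = i + k + i0 := by ring
    rw [this]
    exact h3
  clear_value u
  have hn1 : n - 1 + 1 = n := by omega
  have hne : ∀ i, 1 ≤ i → i < n → u i ≠ (a, b) := by
    intro i h1 h2
    have := hsimu 0 i h1 h2
    rwa [zero_add, hu0] at this
  have nb : ∀ v : ℤ × ℤ, LStep (a, b) v → v ≠ (a, b) → (v.2 < b ∨ (v.2 = b ∧ a ≤ v.1)) →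
      v = (a + 1, b) ∨ v = (a, b - 1) := by
    rintro ⟨v1, v2⟩ h1 h2 h3
    rcases lstep_cases h1 with h | h | h | h | h
    · exact absurd h.symm h2
    all_goals simp only [Prod.mk.injEq] at *
    all_goals omega
  have hsymm : ∀ x y, LStep x y → LStep y x := by
    intro x y h
    unfold LStep at *
    rwa [abs_sub_comm y.1, abs_sub_comm y.2]
  have nb1 := nb (u 1) (by have := huL.step 0; rwa [hu0] at this) (hne 1 le_rfl (by omega))
    (hmaxu 1)
  have nb2 := nb (u (n - 1)) (by
      have := huL.step (n - 1)
      rw [hn1, hun] at this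
      exact hsymm _ _ this) (hne (n - 1) (by omega) (by omega)) (hmaxu _)
  have hdiff : u (n - 1) ≠ u 1 := by
    have := hsimu 1 (n - 2) (by omega) (by omega)
    have e : 1 + (n - 2) = n - 1 := by omega
    rwa [e] at this
  have hcor : (u 1 = (a + 1, b) ∧ u (n - 1) = (a, b - 1)) ∨
      (u 1 = (a, b - 1) ∧ u (n - 1) = (a + 1, b)) := by
    rcases nb1 with h1 | h1 <;> rcases nb2 with h2 | h2
    · exact absurd (h2.trans h1.symm) hdiff
    · exact Or.inl ⟨h1, h2⟩
    · exact Or.inr ⟨h1, h2⟩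
    · exact absurd (h2.trans h1.symm) hdiff
  have hsq : lsq a b ⊆ V := square_subset hV hn3 huL.step huL.seg hu0 hun hne
    (fun i => by rcases hmaxu i with h | h <;> omega) hcor
  set q : ℤ × ℤ := (a + 1, b - 1) with hq
  have mc : lat (a, b) ∈ lsq a b := by simp [lat, lsq]
  have mq : lat q ∈ lsq a b := by simp [lat, lsq, hq]
  have m1 : lat (u 1) ∈ lsq a b := by
    rcases nb1 with h | h <;> rw [h] <;> simp [lat, lsq]
  have m2 : lat (u (n - 1)) ∈ lsq a b := by
    rcases nb2 with h | h <;> rw [h] <;> simp [lat, lsq]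
  have tri : ∀ x y z, lat x ∈ lsq a b → lat y ∈ lsq a b → lat z ∈ lsq a b →
      φ x y * φ y z = φ x z := by
    intro x y z hx hy hz
    apply hφ
    refine (convexHull_min ?_ (convex_lsq a b)).trans hsq
    intro t ht
    simp only [mem_insert_iff, mem_singleton_iff] at ht
    rcases ht with rfl | rfl | rfl <;> assumption
  have sgV : ∀ x y, lat x ∈ lsq a b → lat y ∈ lsq a b → segment ℝ (lat x) (lat y) ⊆ V :=
    fun x y hx hy => ((convex_lsq a b).segment_subset hx hy).trans hsq
  -- the flipped walk
  set u' : ℕ → ℤ × ℤ := fun i => if i % n = 0 then q else u i with hu'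
  have humod : ∀ i, u i = u (i % n) := by
    intro j
    have : Function.Periodic u n := huL.per
    exact (this.map_mod_nat j).symm
  have hq1 : LStep q (u 1) := by
    rcases nb1 with h | h <;> rw [h] <;> simp [LStep, hq]
  have hq2 : LStep (u (n - 1)) q := by
    rcases nb2 with h | h <;> rw [h] <;> simp [LStep, hq]
  have hedge : ∀ i, (u' i = q ∧ u' (i + 1) = u 1) ∨ (u' i = u (n - 1) ∧ u' (i + 1) = q) ∨
      (u' i = u i ∧ u' (i + 1) = u (i + 1)) := by
    intro i
    have hlt := Nat.mod_lt i hn0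
    by_cases h1 : i % n = 0
    · left
      have h2 : (i + 1) % n = 1 := by
        rw [← Nat.mod_add_mod, h1, zero_add, Nat.mod_eq_of_lt (by omega)]
      refine ⟨by simp [hu', h1], ?_⟩
      simp only [hu', h2, one_ne_zero, if_false]
      rw [humod, h2]
    · by_cases h2 : (i + 1) % n = 0
      · right; left
        have h3 : i % n = n - 1 := by
          by_contra h3
          have : (i + 1) % n = i % n + 1 := by
            rw [← Nat.mod_add_mod, Nat.mod_eq_of_lt (by omega)]
          omega
        refine ⟨?_, by simp [hu', h2]⟩
        simp only [hu', h1, if_false]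
        rw [humod, h3]
      · right; right
        simp [hu', h1, h2]
  have hu'L : LLoop V M n u' := by
    refine ⟨fun i => ?_, fun i => ?_, fun i => ?_, fun i => ?_⟩
    · simp only [hu', Nat.add_mod_right, huL.per]
    · rcases hedge i with ⟨h1, h2⟩ | ⟨h1, h2⟩ | ⟨h1, h2⟩ <;> rw [h1, h2]
      · exact hq1
      · exact hq2
      · exact huL.step i
    · rcases hedge i with ⟨h1, h2⟩ | ⟨h1, h2⟩ | ⟨h1, h2⟩ <;> rw [h1, h2]
      · exact sgV _ _ mq m1
      · exact sgV _ _ m2 mq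
      · exact huL.seg i
    · by_cases h : i % n = 0
      · simp only [hu', h, if_true, hq]
        have l1 := huL.low 1
        have l2 := huL.low (n - 1)
        rcases hcor with ⟨h1, h2⟩ | ⟨h1, h2⟩
        · rw [h2] at l2; exact l2
        · rw [h1] at l1; exact l1
      · simp only [hu', h, if_false]
        exact huL.low i
  have hu'0 : u' 0 = q := by simp [hu']
  have hu'n : u' n = q := by simp [hu']
  have hu'i : ∀ i, 1 ≤ i → i < n → u' i = u i := by
    intro i h1 h2
    have : i % n ≠ 0 := by rw [Nat.mod_eq_of_lt h2]; omega
    simp only [hu', this, if_false]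
  have hsum' : ∑ i ∈ Finset.range n, ((u' i).2 - M) = (s : ℤ) - 1 := by
    rw [← husum, ← hn1, Finset.sum_range_succ', Finset.sum_range_succ', hu'0, hu0]
    have : ∑ k ∈ Finset.range (n - 1), ((u' (k + 1)).2 - M) =
        ∑ k ∈ Finset.range (n - 1), ((u (k + 1)).2 - M) := by
      apply Finset.sum_congr rfl
      intro k hk
      rw [Finset.mem_range] at hk
      rw [hu'i (k + 1) (by omega) (by omega)]
    rw [this]
    simp only [hq]
    ring
  have hs1 : 1 ≤ s := by
    have : (0 : ℤ) ≤ (s : ℤ) - 1 := by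
      rw [← hsum']
      exact Finset.sum_nonneg fun i _ => sub_nonneg.2 (hu'L.low i)
    omega
  have hfin := ihs (s - 1) (by omega) u' hu'L (by rw [hsum']; omega)
  have expand : ∀ v : ℕ → ℤ × ℤ, hol φ v n =
      φ (v 0) (v 1) * hol φ (fun i => v (i + 1)) (n - 2) * φ (v (n - 1)) (v n) := by
    intro v
    have e1 : n = 1 + (n - 2) + 1 := by omega
    have e2 : 1 + (n - 2) = n - 1 := by omega
    conv_lhs => rw [e1]
    rw [hol, hol_add, hol_one, e2, hn1]
  rw [expand, hu'0, hu'n, hu'i 1 le_rfl (by omega), hu'i (n - 1) (by omega) (by omega)] at hfin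
  have hmid : hol φ (fun i => u' (i + 1)) (n - 2) = hol φ (fun i => u (i + 1)) (n - 2) := by
    apply hol_congr
    intro i hi
    exact hu'i (i + 1) (by omega) (by omega)
  rw [hmid] at hfin
  rw [expand, hu0, hun]
  have t1 := tri _ _ _ m2 mc m1
  have t2 := tri _ _ _ m2 mq m1
  set X := hol φ (fun i => u (i + 1)) (n - 2)
  have t3 : φ (u (n - 1)) (a, b) * φ (a, b) (u 1) = φ (u (n - 1)) q * φ q (u 1) := by
    rw [t1, t2]
  have hX : X = (φ q (u 1))⁻¹ * (φ (u (n - 1)) q)⁻¹ := by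
    rw [eq_mul_inv_iff_mul_eq, eq_inv_iff_mul_eq_one, mul_eq_one_iff_eq_inv]
    rw [mul_assoc, mul_eq_one_iff_eq_inv] at hfin
    rw [hfin, inv_inv]
  rw [← mul_inv_rev, ← t3, mul_inv_rev] at hX
  rw [hX]
  group


/-! ### From paths to lattice loops -/

section Loops

lemma homotopic_of_convex {V C : Set ℂ} (hC : Convex ℝ C) (hCV : C ⊆ V) {u v : V}
    (p q : Path u v) (hp : ∀ t, (p t : ℂ) ∈ C) (hq : ∀ t, (q t : ℂ) ∈ C) : p.Homotopic q := by
  have hu : (u : ℂ) ∈ C := by simpa using hp 0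
  have hv : (v : ℂ) ∈ C := by simpa using hp 1
  have : ContractibleSpace C := hC.contractibleSpace ⟨u, hu⟩
  let p' : Path (⟨u, hu⟩ : C) ⟨v, hv⟩ :=
    { toFun := fun t => ⟨p t, hp t⟩
      continuous_toFun := by fun_prop
      source' := by simp
      target' := by simp }
  let q' : Path (⟨u, hu⟩ : C) ⟨v, hv⟩ :=
    { toFun := fun t => ⟨q t, hq t⟩
      continuous_toFun := by fun_prop
      source' := by simp
      target' := by simp }
  have h : p'.Homotopic q' := SimplyConnectedSpace.paths_homotopic p' q'
  have := h.map ⟨Set.inclusion hCV, continuous_inclusion hCV⟩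
  exact this

/-- The straight path in `V`. -/
noncomputable def segPath {V : Set ℂ} (u v : V) (h : segment ℝ (u : ℂ) v ⊆ V) : Path u v where
  toFun t := ⟨AffineMap.lineMap (u : ℂ) (v : ℂ) (t : ℝ), h (by
    rw [segment_eq_image_lineMap]
    exact ⟨t, t.2, rfl⟩)⟩
  continuous_toFun := by
    apply Continuous.subtype_mk
    exact AffineMap.lineMap_continuous.comp continuous_subtype_val
  source' := by simp
  target' := by simp

lemma segPath_mem {V : Set ℂ} (u v : V) (h : segment ℝ (u : ℂ) v ⊆ V) (t : unitInterval) :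
    (segPath u v h t : ℂ) ∈ segment ℝ (u : ℂ) v := by
  rw [segment_eq_image_lineMap]
  exact ⟨t, t.2, rfl⟩

lemma quot_cancel {V : Set ℂ} {u v z : V} (c : Path.Homotopic.Quotient u v)
    (r : Path.Homotopic.Quotient v z) : c.symm.trans (c.trans r) = r := by
  rw [← Path.Homotopic.Quotient.trans_assoc, Path.Homotopic.Quotient.symm_trans,
    Path.Homotopic.Quotient.refl_trans]

variable {V : Set ℂ} [PathConnectedSpace V] (x : V)

/-- Transport of path classes to loops at the base point. -/
noncomputable def trp {u v : V} (p : Path.Homotopic.Quotient u v) : (FundamentalGroup V x)ᵐᵒᵖ :=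
  MulOpposite.op (FundamentalGroup.fromPath
    (((Path.Homotopic.Quotient.mk (PathConnectedSpace.somePath x u)).trans p).trans
      (Path.Homotopic.Quotient.mk (PathConnectedSpace.somePath x v)).symm))

lemma trp_trans {u v z : V} (p : Path.Homotopic.Quotient u v) (q : Path.Homotopic.Quotient v z) :
    trp x (p.trans q) = trp x p * trp x q := by
  unfold trp
  rw [← MulOpposite.op_mul, FundamentalGroup.mul_def]
  congr 1
  generalize Path.Homotopic.Quotient.mk (PathConnectedSpace.somePath x u) = c
  generalize Path.Homotopic.Quotient.mk (PathConnectedSpace.somePath x v) = d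
  generalize Path.Homotopic.Quotient.mk (PathConnectedSpace.somePath x z) = e
  change (c.trans (p.trans q)).trans e.symm =
    ((c.trans p).trans d.symm).trans ((d.trans q).trans e.symm)
  simp only [Path.Homotopic.Quotient.trans_assoc, quot_cancel]

lemma trp_refl {u : V} : trp x (Path.Homotopic.Quotient.refl u) = 1 := by
  unfold trp
  rw [← MulOpposite.op_one, FundamentalGroup.one_def]
  congr 1
  simp [FundamentalGroup.fromPath]

lemma trp_eq_one {u : V} (p : Path.Homotopic.Quotient u u) (h : trp x p = 1) :
    p = Path.Homotopic.Quotient.refl u := by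
  unfold trp at h
  rw [← MulOpposite.op_one, FundamentalGroup.one_def] at h
  have h := MulOpposite.op_injective h
  simp only [FundamentalGroup.fromPath] at h
  set c := Path.Homotopic.Quotient.mk (PathConnectedSpace.somePath x u)
  have h2 : (c.symm.trans ((c.trans p).trans c.symm)).trans c =
    (c.symm.trans (Path.Homotopic.Quotient.refl x)).trans c := congrArg (fun r => (c.symm.trans r).trans c) h
  simpa [quot_cancel] using h2

open Classical in
/-- The cocycle attached to segments in `V`. -/
noncomputable def coc (u v : ℂ) : (FundamentalGroup V x)ᵐᵒᵖ :=
  if h : segment ℝ u v ⊆ V then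
    trp x (Path.Homotopic.Quotient.mk
      (segPath (⟨u, h (left_mem_segment _ _ _)⟩ : V) ⟨v, h (right_mem_segment _ _ _)⟩ h))
  else 1

lemma coc_eq {C : Set ℂ} (hC : Convex ℝ C) (hCV : C ⊆ V) {u v : V}
    (p : Path u v) (hp : ∀ t, (p t : ℂ) ∈ C) :
    coc x (u : ℂ) (v : ℂ) = trp x (Path.Homotopic.Quotient.mk p) := by
  have hu : (u : ℂ) ∈ C := by simpa using hp 0
  have hv : (v : ℂ) ∈ C := by simpa using hp 1
  have hs : segment ℝ (u : ℂ) v ⊆ C := hC.segment_subset hu hv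
  unfold coc
  rw [dif_pos (hs.trans hCV)]
  congr 1
  rw [Path.Homotopic.Quotient.eq]
  exact homotopic_of_convex hC hCV _ _ (fun t => hs (segPath_mem _ _ (hs.trans hCV) t)) hp

lemma coc_trans {C : Set ℂ} (hC : Convex ℝ C) (hCV : C ⊆ V) {u v z : ℂ} (hu : u ∈ C) (hv : v ∈ C)
    (hz : z ∈ C) : coc x u v * coc x v z = coc x u z := by
  have h1 := hC.segment_subset hu hv
  have h2 := hC.segment_subset hv hz
  let u' : V := ⟨u, hCV hu⟩
  let v' : V := ⟨v, hCV hv⟩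
  let z' : V := ⟨z, hCV hz⟩
  let p : Path u' v' := segPath u' v' (h1.trans hCV)
  let q : Path v' z' := segPath v' z' (h2.trans hCV)
  have hp : ∀ t, (p t : ℂ) ∈ C := fun t => h1 (segPath_mem u' v' (h1.trans hCV) t)
  have hq : ∀ t, (q t : ℂ) ∈ C := fun t => h2 (segPath_mem v' z' (h2.trans hCV) t)
  have e1 : coc x u v = _ := coc_eq x hC hCV p hp
  have e2 : coc x v z = _ := coc_eq x hC hCV q hq
  have e3 : coc x u z = _ := coc_eq x hC hCV (p.trans q) (by
    intro t
    rw [Path.trans_apply]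
    split_ifs
    · exact hp _
    · exact hq _)
  rw [e1, e2, e3, Path.Homotopic.Quotient.mk_trans, trp_trans]

end Loops


/-! ### Grid approximation of loops -/

lemma HasLogs.scale {V : Set ℂ} (hV : HasLogs V) {h : ℝ} (hh : 0 < h) :
    HasLogs ((fun y : ℂ => h • y) ⁻¹' V) := by
  intro p hp L hL hLV
  have hc : Continuous (fun y : ℂ => h • y) := continuous_const_smul h
  obtain ⟨g, hg, hg'⟩ := hV (h • p) hp ((fun y : ℂ => h • y) '' L) (hL.image hc)
    (by rintro _ ⟨y, hy, rfl⟩; exact hLV hy)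
  refine ⟨fun y => g (h • y) - (Real.log h : ℂ), ?_, fun z hz => ?_⟩
  · refine ContinuousOn.sub (hg.comp hc.continuousOn (mapsTo_image _ _)) continuousOn_const
  · have hne : (h : ℂ) ≠ 0 := by exact_mod_cast hh.ne'
    rw [Complex.exp_sub, hg' _ ⟨z, hz, rfl⟩, ← Complex.ofReal_exp, Real.exp_log hh]
    simp only [Complex.real_smul]
    field_simp

lemma floor_close {a b : ℝ} (h : |a - b| < 1) : |⌊a⌋ - ⌊b⌋| ≤ 1 := by
  have h1 := abs_lt.1 h
  have ha1 := Int.floor_le a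
  have ha2 := Int.lt_floor_add_one a
  have hb1 := Int.floor_le b
  have hb2 := Int.lt_floor_add_one b
  have e1 : (⌊a⌋ : ℝ) < ⌊b⌋ + 2 := by linarith
  have e2 : (⌊b⌋ : ℝ) < ⌊a⌋ + 2 := by linarith
  have e1' : ⌊a⌋ < ⌊b⌋ + 2 := by exact_mod_cast e1
  have e2' : ⌊b⌋ < ⌊a⌋ + 2 := by exact_mod_cast e2
  rw [abs_le]
  omega

lemma floor_mul_near {a h : ℝ} (hh : 0 < h) : |h * (⌊a / h⌋ : ℝ) - a| ≤ h := by
  have h1 := Int.floor_le (a / h)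
  have h2 := Int.lt_floor_add_one (a / h)
  rw [le_div_iff₀ hh] at h1
  rw [div_lt_iff₀ hh] at h2
  rw [abs_le]
  constructor <;> nlinarith

lemma mem_ball_of_near {z c : ℂ} {h δ : ℝ} (hh : 0 < h) (hδ : 5 * h ≤ δ)
    (h1 : |z.re - c.re| ≤ 2 * h) (h2 : |z.im - c.im| ≤ 2 * h) : z ∈ ball c δ := by
  rw [mem_ball, dist_eq_norm]
  have := Complex.norm_le_abs_re_add_abs_im (z - c)
  rw [Complex.sub_re, Complex.sub_im] at this
  linarith

lemma hol_grid {V : Set ℂ} [PathConnectedSpace V] (x : V) (hlog : HasLogs V) (hVb : IsBounded V)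
    {δ h : ℝ} (hh : 0 < h) (hδ : 5 * h ≤ δ) (z : ℕ → ℂ) (hball : ∀ i, ball (z i) δ ⊆ V)
    (hstep : ∀ i, dist (z i) (z (i + 1)) < h) {N : ℕ} (hN0 : 0 < N) (hN : z N = z 0) :
    hol (coc x) z N = 1 := by
  let v : ℕ → ℤ × ℤ := fun i => (⌊(z i).re / h⌋, ⌊(z i).im / h⌋)
  let w : ℕ → ℤ × ℤ := fun j => ((v (j / 2)).1, (v ((j + 1) / 2)).2)
  have hw0 : ∀ i, w (2 * i) = v i := by
    intro i
    have e1 : 2 * i / 2 = i := by omega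
    have e2 : (2 * i + 1) / 2 = i := by omega
    simp only [w, e1, e2]
  have hw1 : ∀ i, w (2 * i + 1) = ((v i).1, (v (i + 1)).2) := by
    intro i
    have e2 : (2 * i + 1) / 2 = i := by omega
    have e3 : (2 * i + 1 + 1) / 2 = i + 1 := by omega
    simp only [w, e2, e3]
  have hw2 : ∀ i, w (2 * i + 1 + 1) = v (i + 1) := fun i => hw0 (i + 1)
  let P : ℤ × ℤ → ℂ := fun u => h • lat u
  have hPre : ∀ u, (P u).re = h * u.1 := fun u => by simp [P, lat]
  have hPim : ∀ u, (P u).im = h * u.2 := fun u => by simp [P, lat]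
  have hδ0 : 0 < δ := by linarith
  have hre : ∀ i, |(z i).re - (z (i + 1)).re| < h := fun i => by
    have := Complex.abs_re_le_norm (z i - z (i + 1))
    rw [← dist_eq_norm, Complex.sub_re] at this
    exact this.trans_lt (hstep i)
  have him : ∀ i, |(z i).im - (z (i + 1)).im| < h := fun i => by
    have := Complex.abs_im_le_norm (z i - z (i + 1))
    rw [← dist_eq_norm, Complex.sub_im] at this
    exact this.trans_lt (hstep i)
  have nre : ∀ i, |h * ((v i).1 : ℝ) - (z i).re| ≤ h := fun i => floor_mul_near hh
  have nim : ∀ i, |h * ((v i).2 : ℝ) - (z i).im| ≤ h := fun i => floor_mul_near hh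
  have nre' : ∀ i, |h * ((v (i + 1)).1 : ℝ) - (z i).re| ≤ 2 * h := fun i => by
    have h1 := abs_le.1 (nre (i + 1))
    have h2 := abs_lt.1 (hre i)
    rw [abs_le]; constructor <;> linarith
  have nim' : ∀ i, |h * ((v (i + 1)).2 : ℝ) - (z i).im| ≤ 2 * h := fun i => by
    have h1 := abs_le.1 (nim (i + 1))
    have h2 := abs_lt.1 (him i)
    rw [abs_le]; constructor <;> linarith
  have b0 : ∀ i, P (w (2 * i)) ∈ ball (z i) δ := fun i => by
    apply mem_ball_of_near hh hδ
    · rw [hPre, hw0]; linarith [nre i]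
    · rw [hPim, hw0]; linarith [nim i]
  have b1 : ∀ i, P (w (2 * i + 1)) ∈ ball (z i) δ := fun i => by
    apply mem_ball_of_near hh hδ
    · rw [hPre, hw1]; linarith [nre i]
    · rw [hPim, hw1]; exact nim' i
  have b2 : ∀ i, P (w (2 * i + 1 + 1)) ∈ ball (z i) δ := fun i => by
    apply mem_ball_of_near hh hδ
    · rw [hPre, hw2]; exact nre' i
    · rw [hPim, hw2]; exact nim' i
  have bz : ∀ i, z i ∈ ball (z i) δ := fun i => mem_ball_self hδ0
  have bz' : ∀ i, z (i + 1) ∈ ball (z i) δ := fun i => by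
    rw [mem_ball, dist_comm]
    linarith [hstep i]
  let φ : ℤ × ℤ → ℤ × ℤ → (FundamentalGroup V x)ᵐᵒᵖ := fun u u' => coc x (P u) (P u')
  have hT : ∀ i {a b c : ℂ}, a ∈ ball (z i) δ → b ∈ ball (z i) δ → c ∈ ball (z i) δ →
      coc x a b * coc x b c = coc x a c := fun i a b c ha hb hc =>
    coc_trans x (convex_ball _ _) (hball i) ha hb hc
  have tele : ∀ n, hol (coc x) z n =
      coc x (z 0) (P (w 0)) * hol φ w (2 * n) * coc x (P (w (2 * n))) (z n) := by
    intro n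
    induction n with
    | zero =>
      simp only [hol, mul_zero, mul_one]
      have e := hT 0 (bz 0) (b0 0) (bz 0)
      have e' := hT 0 (bz 0) (bz 0) (bz 0)
      rw [mul_eq_left] at e'
      rw [e'] at e
      exact e.symm
    | succ n ih =>
      have e : hol φ w (2 * (n + 1)) = hol φ w (2 * n) * φ (w (2 * n)) (w (2 * n + 1)) *
        φ (w (2 * n + 1)) (w (2 * n + 1 + 1)) := rfl
      have e2 : w (2 * (n + 1)) = w (2 * n + 1 + 1) := rfl
      rw [hol, ih, e, e2]
      simp only [φ, mul_assoc]
      rw [hT n (b0 n) (bz n) (bz' n), hT n (b1 n) (b2 n) (bz' n), hT n (b0 n) (b1 n) (bz' n)]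
  have wN : w (2 * N) = w 0 := by
    have : w 0 = v 0 := hw0 0
    rw [hw0, this]
    simp only [v, hN]
  obtain ⟨R, hR⟩ := hVb.subset_closedBall (0 : ℂ)
  let M : ℤ := ⌊-R / h⌋
  have hlow : ∀ i, M ≤ (w i).2 := by
    intro i
    apply Int.floor_le_floor
    apply div_le_div_of_nonneg_right _ hh.le
    have h1 := hR (hball ((i + 1) / 2) (bz _))
    rw [mem_closedBall, dist_zero_right] at h1
    have h2 := abs_le.1 ((Complex.abs_im_le_norm _).trans h1)
    exact h2.1
  have par : ∀ j, ∃ i, j = 2 * i ∨ j = 2 * i + 1 := fun j => ⟨j / 2, by omega⟩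
  have hst : ∀ j, LStep (w j) (w (j + 1)) := by
    intro j
    have scale : ∀ a b : ℝ, |a - b| < h → |a / h - b / h| < 1 := by
      intro a b hab
      rw [← sub_div, abs_div, abs_of_pos hh, div_lt_one hh]
      exact hab
    obtain ⟨i, rfl | rfl⟩ := par j
    · rw [hw0, hw1]
      unfold LStep
      have := floor_close (scale _ _ (him i))
      simpa [v] using this
    · rw [hw1, hw2]
      unfold LStep
      have := floor_close (scale _ _ (hre i))
      simpa [v] using this
  have hseg : ∀ j, segment ℝ (lat (w j)) (lat (w (j + 1))) ⊆ (fun y : ℂ => h • y) ⁻¹' V := by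
    intro j
    have key : ∀ i {a b : ℤ × ℤ}, P a ∈ ball (z i) δ → P b ∈ ball (z i) δ →
        segment ℝ (lat a) (lat b) ⊆ (fun y : ℂ => h • y) ⁻¹' V := by
      intro i a b ha hb
      refine Subset.trans ?_ (preimage_mono (hball i))
      exact ((convex_ball (z i) δ).smul_preimage h).segment_subset ha hb
    obtain ⟨i, rfl | rfl⟩ := par j
    · exact key i (b0 i) (b1 i)
    · exact key i (b1 i) (b2 i)
  have hφ : ∀ u u' y, convexHull ℝ {lat u, lat u', lat y} ⊆ (fun y : ℂ => h • y) ⁻¹' V →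
      φ u u' * φ u' y = φ u y := by
    intro u u' y hs
    have hm : ∀ t ∈ ({lat u, lat u', lat y} : Set ℂ),
        h • t ∈ (fun y : ℂ => h • y) '' convexHull ℝ {lat u, lat u', lat y} :=
      fun t ht => mem_image_of_mem _ (subset_convexHull ℝ _ ht)
    exact coc_trans x ((convex_convexHull ℝ _).smul h) (image_subset_iff.2 hs)
      (hm _ (by simp)) (hm _ (by simp)) (hm _ (by simp))
  have hloop := LLoop.piece hst hseg hlow (show 0 < 2 * N by omega) wN
  have hone := hol_eq_one (hlog.scale hh) φ hφ M (2 * N)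
    (∑ i ∈ Finset.range (2 * N), ((w (i % (2 * N))).2 - M)).toNat _ hloop
    (by
      rw [Int.toNat_of_nonneg]
      exact Finset.sum_nonneg fun i _ => sub_nonneg.2 (hlow _))
  rw [hol_piece φ wN] at hone
  rw [tele N, hone, wN, hN, mul_one]
  have e := hT 0 (bz 0) (b0 0) (bz 0)
  have e' := hT 0 (bz 0) (bz 0) (bz 0)
  rw [mul_eq_left] at e'
  rw [e'] at e
  exact e

lemma trp_subpath {V : Set ℂ} [PathConnectedSpace V] {x : V} (γ : Path x x) {δ : ℝ}
    (t : ℕ → unitInterval) (hball : ∀ i, ball (γ (t i) : ℂ) δ ⊆ V)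
    (hsub : ∀ i, ∀ s ∈ uIcc (t i) (t (i + 1)), (γ s : ℂ) ∈ ball (γ (t i) : ℂ) δ) (n : ℕ) :
    trp x (Path.Homotopic.Quotient.mk (γ.subpath (t 0) (t n))) =
      hol (coc x) (fun i => (γ (t i) : ℂ)) n := by
  induction n with
  | zero => rw [Path.subpath_self, Path.Homotopic.Quotient.mk_refl, trp_refl, hol]
  | succ n ih =>
    have e : Path.Homotopic.Quotient.mk (γ.subpath (t 0) (t (n + 1))) =
        (Path.Homotopic.Quotient.mk (γ.subpath (t 0) (t n))).trans
          (Path.Homotopic.Quotient.mk (γ.subpath (t n) (t (n + 1)))) := by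
      rw [← Path.Homotopic.Quotient.mk_trans, Path.Homotopic.Quotient.eq]
      exact ⟨(Path.Homotopy.subpathTransSubpath γ _ _ _).symm⟩
    rw [e, trp_trans, ih, hol]
    congr 1
    symm
    refine coc_eq x (convex_ball _ _) (hball n) _ fun s => ?_
    have hs : γ.subpath (t n) (t (n + 1)) s ∈ range (γ.subpath (t n) (t (n + 1))) := ⟨s, rfl⟩
    rw [Path.range_subpath] at hs
    obtain ⟨r, hr, hr'⟩ := hs
    rw [← hr']
    exact hsub n r hr

theorem simplyConnected_of {V : Set ℂ} (hVo : IsOpen V) (hVc : IsConnected V)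
    (hVb : IsBounded V) (hlog : HasLogs V) : SimplyConnectedSpace V := by
  have hpc : PathConnectedSpace V :=
    isPathConnected_iff_pathConnectedSpace.1 (hVo.isConnected_iff_isPathConnected.1 hVc)
  rw [simply_connected_iff_loops_nullhomotopic]
  refine ⟨hpc, fun x γ => ?_⟩
  rw [← Path.Homotopic.Quotient.eq, Path.Homotopic.Quotient.mk_refl]
  apply trp_eq_one x
  have hcont : Continuous (fun s : unitInterval => (γ s : ℂ)) := by fun_prop
  obtain ⟨δ, hδ, hsub⟩ := (isCompact_range hcont).exists_thickening_subset_open hVo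
    (by rintro _ ⟨s, rfl⟩; exact (γ s).2)
  have hball : ∀ s, ball (γ s : ℂ) δ ⊆ V := fun s =>
    (ball_subset_thickening (mem_range_self s) δ).trans hsub
  have hh : 0 < δ / 5 := by positivity
  have huc := CompactSpace.uniformContinuous_of_continuous hcont
  rw [Metric.uniformContinuous_iff] at huc
  obtain ⟨ε, hε, hclose⟩ := huc (δ / 5) hh
  obtain ⟨n, hn⟩ := exists_nat_one_div_lt hε
  let t : ℕ → unitInterval := fun i => projIcc 0 1 zero_le_one ((i : ℝ) / (n + 1))
  have hn1 : (0 : ℝ) < n + 1 := by positivity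
  have ht : ∀ i, dist (t i) (t (i + 1)) < ε := by
    intro i
    have h1 : dist (t i) (t (i + 1)) ≤ |(i : ℝ) / (n + 1) - ((i + 1 : ℕ) : ℝ) / (n + 1)| :=
      abs_projIcc_sub_projIcc zero_le_one
    have h2 : (i : ℝ) / (n + 1) - ((i + 1 : ℕ) : ℝ) / (n + 1) = - (1 / (n + 1)) := by
      push_cast; field_simp; ring
    rw [h2, abs_neg, abs_of_pos (by positivity)] at h1
    exact h1.trans_lt hn
  have ht0 : t 0 = 0 := by simp [t]
  have htn : t (n + 1) = 1 := by
    have : ((n + 1 : ℕ) : ℝ) / (n + 1) = 1 := by push_cast; field_simp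
    simp only [t, this]
    simp
  have key := trp_subpath γ t (fun i => hball (t i)) (δ := δ) (by
    intro i s hs
    have h1 : dist s (t i) ≤ dist (t i) (t (i + 1)) := by
      rw [Subtype.dist_eq, Subtype.dist_eq, Real.dist_eq, Real.dist_eq]
      rcases le_total (t i) (t (i + 1)) with h | h
      · rw [uIcc_of_le h] at hs
        have a1 : (t i : ℝ) ≤ s := hs.1
        have a2 : (s : ℝ) ≤ t (i + 1) := hs.2
        rw [abs_of_nonneg (by linarith), abs_of_nonpos (by linarith)]
        linarith
      · rw [uIcc_of_ge h] at hs
        have a1 : (t (i + 1) : ℝ) ≤ s := hs.1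
        have a2 : (s : ℝ) ≤ t i := hs.2
        rw [abs_of_nonpos (by linarith), abs_of_nonneg (by linarith)]
        linarith
    have := hclose (h1.trans_lt (ht i))
    rw [mem_ball]
    linarith) (n + 1)
  rw [hol_grid x hlog hVb hh (by linarith) (fun i => (γ (t i) : ℂ)) (fun i => hball (t i))
    (fun i => hclose (ht i)) (Nat.succ_pos n) (by simp only [Nat.succ_eq_add_one, htn, ht0]; simp)] at key
  have gen : ∀ (a b : unitInterval) (ha : a = 0) (hb : b = 1),
      trp x (Path.Homotopic.Quotient.mk (γ.subpath a b)) =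
        trp x (Path.Homotopic.Quotient.mk γ) := by
    rintro a b rfl rfl
    rw [Path.subpath_zero_one]
    have gen2 : ∀ (p q : V) (hp : p = x) (hq : q = x),
        trp x (Path.Homotopic.Quotient.mk (γ.cast hp hq)) =
          trp x (Path.Homotopic.Quotient.mk γ) := by
      rintro p q rfl rfl
      rfl
    exact gen2 _ _ _ _
  rw [← gen _ _ ht0 htn]
  exact key

lemma hasLogs_filling (U : Set ℂ) : HasLogs (filling U) := by
  intro p hp L hL hLV
  have h := mem_compl_filling.1 (show p ∈ (filling U)ᶜ from hp)
  refine exists_log_sub hL isPreconnected_connectedComponentIn h.2 ?_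
    (mem_connectedComponentIn h.1)
  rw [Set.disjoint_left]
  intro y hy hyL
  exact component_subset_compl_filling hp hy (hLV hyL)

theorem filling_properties (U : Set ℂ) (hUo : IsOpen U) (hUc : IsConnected U)
    (hUb : IsBounded U) :
    IsOpen (filling U) ∧ IsBounded (filling U) ∧ IsConnected (filling U) ∧
      SimplyConnectedSpace (filling U) ∧ frontier (filling U) ⊆ frontier U := by
  obtain ⟨h1, h2, h3, h4⟩ := filling_basic U hUo hUc hUb
  exact ⟨h1, h2, h3, simplyConnected_of h1 h3 h2 (hasLogs_filling U), h4⟩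
end
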